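/- Let n ≥ 1, s ∈ (0,1), N ≥ 1 and R > 0. There exists an increasing sequence 0 < r_1 < r_2 < ⋯ < r_{2N−1} < r_{2N} = R such that, setting E = ⋃_{k=1}^{N} (B_{r_{2k}} \ B_{r_{2k−1}}), the principal values H_s(x_{r_i}, E) exist for all i ∈ {1,…,2N} (x_{r_i} ∈ ∂B_{r_i}), and r_i · H_s(x_R, E) + (−1)^{i−1} · R · H_s(x_{r_i}, E) = 0 for every i ∈ {1,…,2N−1}. (These equations say that E is a homothetically shrinking solution of the fractional mean curvature flow.) -/

import Mathlib

open MeasureTheory Filter Metric Set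

/-- `HasFracMeanCurvAt n s E x H` means that the fractional mean curvature of
`E ⊆ ℝⁿ` at the point `x`, i.e. the principal value
`lim_{ε→0⁺} ∫_{|y-x|>ε} (χ_{Eᶜ}(y) - χ_E(y)) |x-y|^{-(n+s)} dy`, exists and equals `H`. -/
def HasFracMeanCurvAt (n : ℕ) (s : ℝ) (E : Set (EuclideanSpace ℝ (Fin n)))
    (x : EuclideanSpace ℝ (Fin n)) (H : ℝ) : Prop :=
  Tendsto (fun ε : ℝ =>
      ∫ y in {y : EuclideanSpace ℝ (Fin n) | ε < dist y x},
        (Set.indicator Eᶜ (fun _ => (1 : ℝ)) y - Set.indicator E (fun _ => (1 : ℝ)) y)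
          * ‖x - y‖ ^ (-((n : ℝ) + s)))
    (nhdsWithin 0 (Set.Ioi 0)) (nhds H)

open scoped Topology

/-- The quadratic form `∑ (-1)^(i+j) S(r_i, r_j)` attached to a kernel `S` and radii `r`. -/
noncomputable def altQuad (A : Finset ℕ) (S : ℝ → ℝ → ℝ) (r : ℕ → ℝ) : ℝ :=
  ∑ i ∈ A, ∑ j ∈ A, (-1 : ℝ) ^ i * ((-1 : ℝ) ^ j * S (r i) (r j))

lemma altQuad_update {A : Finset ℕ} {S : ℝ → ℝ → ℝ} (hS : ∀ a b, S a b = S b a) (r : ℕ → ℝ)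
    {i : ℕ} (hi : i ∈ A) (t : ℝ) :
    altQuad A S (Function.update r i t) =
      S t t + 2 * ∑ j ∈ A.erase i, (-1 : ℝ) ^ i * ((-1 : ℝ) ^ j * S t (r j))
        + altQuad (A.erase i) S r := by
  have hu : ∀ j ∈ A.erase i, Function.update r i t j = r j := fun j hj =>
    Function.update_of_ne (Finset.ne_of_mem_erase hj) _ _
  have hsq : (-1 : ℝ) ^ i * (-1 : ℝ) ^ i = 1 := by
    rw [← mul_pow]; norm_num
  unfold altQuad
  rw [← Finset.add_sum_erase A _ hi]
  have h1 : ∑ j ∈ A, (-1 : ℝ) ^ i * ((-1 : ℝ) ^ j *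
      S (Function.update r i t i) (Function.update r i t j)) =
      S t t + ∑ j ∈ A.erase i, (-1 : ℝ) ^ i * ((-1 : ℝ) ^ j * S t (r j)) := by
    rw [← Finset.add_sum_erase A _ hi, Function.update_self, ← mul_assoc, hsq, one_mul]
    congr 1
    exact Finset.sum_congr rfl fun j hj => by rw [hu j hj]
  have h2 : ∀ k ∈ A.erase i, ∑ j ∈ A, (-1 : ℝ) ^ k * ((-1 : ℝ) ^ j *
      S (Function.update r i t k) (Function.update r i t j)) =
      (-1 : ℝ) ^ i * ((-1 : ℝ) ^ k * S t (r k)) +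
        ∑ j ∈ A.erase i, (-1 : ℝ) ^ k * ((-1 : ℝ) ^ j * S (r k) (r j)) := by
    intro k hk
    rw [← Finset.add_sum_erase A _ hi, Function.update_self, hu k hk, hS (r k) t]
    congr 1
    · ring
    exact Finset.sum_congr rfl fun j hj => by rw [hu j hj]
  rw [h1, Finset.sum_congr rfl h2, Finset.sum_add_distrib]
  ring

lemma alternating_sum_pair {m i : ℕ} (hi : 1 ≤ i) (him : i < m) (f : ℝ → ℝ) {r r' : ℕ → ℝ}
    (h : r i = r (i + 1)) (h' : r' i = r' (i + 1))
    (hr : ∀ j, j ≠ i → j ≠ i + 1 → r' j = r j) :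
    ∑ j ∈ Finset.Icc 1 m, (-1 : ℝ) ^ j * f (r' j) =
      ∑ j ∈ Finset.Icc 1 m, (-1 : ℝ) ^ j * f (r j) := by
  rw [← sub_eq_zero, ← Finset.sum_sub_distrib]
  have hsub : ({i, i + 1} : Finset ℕ) ⊆ Finset.Icc 1 m := by
    intro j hj
    simp only [Finset.mem_insert, Finset.mem_singleton] at hj
    rw [Finset.mem_Icc]
    omega
  rw [← Finset.sum_subset hsub]
  · rw [Finset.sum_pair (by omega), ← h, ← h', pow_succ]
    ring
  · intro j _ hj
    simp only [Finset.mem_insert, Finset.mem_singleton, not_or] at hj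
    rw [hr j hj.1 hj.2, sub_self]

lemma altQuad_pair {m i : ℕ} (hi : 1 ≤ i) (him : i < m) (S : ℝ → ℝ → ℝ) {r r' : ℕ → ℝ}
    (h : r i = r (i + 1)) (h' : r' i = r' (i + 1))
    (hr : ∀ j, j ≠ i → j ≠ i + 1 → r' j = r j) :
    altQuad (Finset.Icc 1 m) S r' = altQuad (Finset.Icc 1 m) S r := by
  unfold altQuad
  simp only [← Finset.mul_sum]
  rw [alternating_sum_pair hi him
    (fun x => ∑ j ∈ Finset.Icc 1 m, (-1 : ℝ) ^ j * S x (r' j)) h h' hr]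
  refine Finset.sum_congr rfl fun k _ => ?_
  rw [alternating_sum_pair hi him (fun x => S (r k) x) h h' hr]

lemma abs_altQuad_le {A : Finset ℕ} {S : ℝ → ℝ → ℝ} {r : ℕ → ℝ} {C : ℝ}
    (hC : ∀ i ∈ A, ∀ j ∈ A, |S (r i) (r j)| ≤ C) :
    |altQuad A S r| ≤ A.card * (A.card * C) := by
  unfold altQuad
  refine (Finset.abs_sum_le_sum_abs _ _).trans ?_
  rw [← nsmul_eq_mul]
  refine Finset.sum_le_card_nsmul _ _ _ fun i hi => ?_
  refine (Finset.abs_sum_le_sum_abs _ _).trans ?_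
  rw [← nsmul_eq_mul]
  refine Finset.sum_le_card_nsmul _ _ _ fun j hj => ?_
  simpa [abs_mul] using hC i hi j hj

lemma sum_erase_update {A : Finset ℕ} (f : ℝ → ℝ) (r : ℕ → ℝ) {i : ℕ} (hi : i ∈ A) (t : ℝ) :
    ∑ j ∈ A, f (Function.update r i t j) = f t + ∑ j ∈ A.erase i, f (r j) := by
  rw [← Finset.add_sum_erase A _ hi, Function.update_self]
  congr 1
  exact Finset.sum_congr rfl fun j hj => by
    rw [Function.update_of_ne (Finset.ne_of_mem_erase hj)]

lemma monotone_of_step {m : ℕ} {r : ℕ → ℝ} (h : ∀ i, 1 ≤ i → i < m → r i ≤ r (i + 1)) {i j : ℕ}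
    (hi : 1 ≤ i) (hij : i ≤ j) (hj : j ≤ m) : r i ≤ r j := by
  induction j, hij using Nat.le_induction with
  | base => rfl
  | succ k hk ih => exact (ih (by omega)).trans (h k (by omega) (by omega))

lemma strictMono_of_step {m : ℕ} {r : ℕ → ℝ} (h : ∀ i, 1 ≤ i → i < m → r i < r (i + 1)) {i j : ℕ}
    (hi : 1 ≤ i) (hij : i < j) (hj : j ≤ m) : r i < r j :=
  (h i hi (by omega)).trans_le
    (monotone_of_step (fun k hk hkm => (h k hk hkm).le) (by omega) hij hj)

/-- Maximising `altQuad S r - ∑ (κ r_i^α + r_i^β)` over ordered tuples of radii. -/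
theorem exists_critical_radii (m : ℕ) (hm : 1 ≤ m) {α : ℝ} (hα : 0 < α) {β : ℕ} (hαβ : α < β)
    {S dS : ℝ → ℝ → ℝ} (hS : ∀ a b, S a b = S b a)
    (hcont : ContinuousOn (fun p : ℝ × ℝ => S p.1 p.2) (Ici 0 ×ˢ Ici 0)) {G κ : ℝ}
    (hκ : 0 ≤ κ) (hκG : κ < G) (hdiag : ∀ v, 0 ≤ v → S v v = G * v ^ α)
    (hbound : ∀ a b M, 0 ≤ a → a ≤ M → 0 ≤ b → b ≤ M → |S a b| ≤ G * M ^ α)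
    (hS0 : ∀ b, 0 ≤ b → S 0 b = 0)
    (hsmall : ∀ b, 0 ≤ b → Tendsto (fun δ => S δ b / δ ^ α) (𝓝[>] 0) (𝓝 0))
    (hder : ∀ a b, 0 < a → 0 < b → a ≠ b → HasDerivAt (fun t => S t b) (dS a b) a) :
    ∃ r : ℕ → ℝ, 0 < r 1 ∧ (∀ i, 1 ≤ i → i < m → r i < r (i + 1)) ∧
      ∀ i ∈ Finset.Icc 1 m, (G - κ) * (α * r i ^ (α - 1)) +
        2 * ∑ j ∈ (Finset.Icc 1 m).erase i, (-1 : ℝ) ^ i * ((-1 : ℝ) ^ j * dS (r i) (r j)) =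
          β * r i ^ (β - 1) := by
  have hβ0 : β ≠ 0 := by rintro rfl; norm_num at hαβ; linarith
  set A := Finset.Icc 1 m with hA
  set φ : ℝ → ℝ := fun v => κ * v ^ α + v ^ β with hφ
  set J : ℝ × (ℕ → ℝ) → ℝ := fun p => altQuad A S p.2 - ∑ i ∈ A, φ (p.2 i) with hJ
  have hφ0 : ∀ v, 0 ≤ v → 0 ≤ φ v := fun v hv => by positivity
  obtain ⟨M, hM0, hM⟩ : ∃ M : ℝ, 0 < M ∧ (A.card : ℝ) * (A.card * (G * M ^ α)) < M ^ β := by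
    have ht : Tendsto (fun M : ℝ => M ^ ((β : ℝ) - α)) atTop atTop :=
      tendsto_rpow_atTop (by linarith)
    obtain ⟨M, hM1, hM2⟩ := ((ht.eventually_gt_atTop ((A.card : ℝ) * (A.card * G))).and
      (eventually_gt_atTop 0)).exists
    refine ⟨M, hM2, ?_⟩
    have : M ^ β = M ^ ((β : ℝ) - α) * M ^ α := by
      rw [← Real.rpow_add hM2]; simp
    rw [this]
    have hp : 0 < M ^ α := by positivity
    nlinarith
  set D : Set (ℕ → ℝ) := {r | (∀ i, r i ∈ Icc 0 M) ∧ ∀ i, 1 ≤ i → i < m → r i ≤ r (i + 1)} with hD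
  have hDc : IsCompact D := by
    have hK : IsCompact (Set.pi univ fun _ : ℕ => Icc (0 : ℝ) M) :=
      isCompact_univ_pi fun _ => isCompact_Icc
    refine hK.of_isClosed_subset ?_ fun r hr i _ => hr.1 i
    simp only [hD, ofPred_and, ofPred_forall]
    refine IsClosed.inter (isClosed_iInter fun i => ?_)
      (isClosed_iInter fun i => isClosed_iInter fun _ => isClosed_iInter fun _ => ?_)
    · exact isClosed_Icc.preimage (continuous_apply i)
    · exact isClosed_le (continuous_apply i) (continuous_apply (i + 1))
  have hJc : ContinuousOn (fun r => J (0, r)) D := by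
    simp only [hJ, altQuad]
    refine ContinuousOn.sub (continuousOn_finsetSum _ fun i _ => continuousOn_finsetSum _
      fun j _ => ?_) (continuousOn_finsetSum _ fun i _ => ?_)
    · refine continuousOn_const.mul (continuousOn_const.mul ?_)
      exact hcont.comp (f := fun r : ℕ → ℝ => (r i, r j)) (by fun_prop)
        fun r hr => ⟨(hr.1 i).1, (hr.1 j).1⟩
    · simp only [hφ]
      refine ContinuousOn.add (continuousOn_const.mul ?_) (by fun_prop)
      exact (continuous_apply i).continuousOn.rpow_const fun _ _ => Or.inr hα.le
  have h0D : (fun _ => 0 : ℕ → ℝ) ∈ D := ⟨fun _ => ⟨le_rfl, hM0.le⟩, fun _ _ _ => le_rfl⟩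
  obtain ⟨r, hrD, hrmax⟩ := hDc.exists_isMaxOn ⟨_, h0D⟩ hJc
  have hmax : ∀ r' ∈ D, J (0, r') ≤ J (0, r) := fun r' hr' => hrmax hr'
  have hmono := fun {i j : ℕ} => @monotone_of_step m r hrD.2 i j
  have hJ0 : J (0, fun _ => 0) = 0 := by
    simp [hJ, altQuad, hS0 0 le_rfl, hφ, hα.ne', hβ0]
  have hlast : r m < M := by
    by_contra hcon
    have heq : r m = M := le_antisymm (hrD.1 m).2 (not_lt.1 hcon)
    have h1 := hmax _ h0D
    rw [hJ0] at h1
    have h2 : |altQuad A S r| ≤ A.card * (A.card * (G * M ^ α)) := abs_altQuad_le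
      fun i _ j _ => hbound _ _ _ (hrD.1 i).1 (hrD.1 i).2 (hrD.1 j).1 (hrD.1 j).2
    have h3 : φ (r m) ≤ ∑ i ∈ A, φ (r i) :=
      Finset.single_le_sum (f := fun i => φ (r i)) (fun i _ => hφ0 _ (hrD.1 i).1)
        (Finset.mem_Icc.2 ⟨hm, le_rfl⟩)
    have h4 : M ^ β ≤ φ (r m) := by
      rw [heq]; simp only [hφ]
      have : 0 ≤ κ * M ^ α := by positivity
      linarith
    have h5 := le_abs_self (altQuad A S r)
    simp only [hJ] at h1
    linarith
  -- no two positive radii coincide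
  have hne : ∀ i, 1 ≤ i → i < m → 0 < r i → r i < r (i + 1) := by
    by_contra hcon
    push Not at hcon
    classical
    let P : ℕ → Prop := fun i => 1 ≤ i ∧ i < m ∧ 0 < r i ∧ r (i + 1) ≤ r i
    have hP : ∃ i, P i := by
      obtain ⟨i, h1, h2, h3, h4⟩ := hcon
      exact ⟨i, h1, h2, h3, h4⟩
    obtain ⟨h1, h2, h3, h4⟩ := Nat.find_spec hP
    have hmin := fun k => @Nat.find_min _ _ hP k
    set i := Nat.find hP
    have heq : r i = r (i + 1) := le_antisymm (hrD.2 i h1 h2) h4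
    obtain ⟨u, hu0, hui, huprev⟩ : ∃ u, 0 ≤ u ∧ u < r i ∧ (2 ≤ i → u = r (i - 1)) := by
      rcases Nat.lt_or_ge i 2 with hi2 | hi2
      · exact ⟨0, le_rfl, h3, fun h => by omega⟩
      · refine ⟨r (i - 1), (hrD.1 _).1, ?_, fun _ => rfl⟩
        rcases (hrD.1 (i - 1)).1.eq_or_lt with h | h
        · rwa [← h]
        · have := hmin (i - 1) (by omega)
          simp only [P, not_and, not_le] at this
          have h6 := this (by omega) (by omega) h
          rwa [Nat.sub_add_cancel h1] at h6
    set r' : ℕ → ℝ := fun j => if j = i ∨ j = i + 1 then u else r j with hr'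
    have hr'i : r' i = u := by simp [hr']
    have hr'i1 : r' (i + 1) = u := by simp [hr']
    have hoff : ∀ j, j ≠ i → j ≠ i + 1 → r' j = r j := fun j hj hj1 => by simp [hr', hj, hj1]
    have hr'D : r' ∈ D := by
      refine ⟨fun j => ?_, fun j hj hjm => ?_⟩
      · by_cases hji : j = i ∨ j = i + 1
        · simp only [hr', hji, if_true]
          exact ⟨hu0, hui.le.trans (hrD.1 i).2⟩
        · simp only [hr', hji, if_false]
          exact hrD.1 j
      · rcases eq_or_ne j i with rfl | hji
        · rw [hr'i, hr'i1]
        rcases eq_or_ne j (i + 1) with rfl | hji1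
        · rw [hr'i1, hoff _ (by omega) (by omega)]
          exact hui.le.trans (hmono h1 (by omega) (by omega))
        rcases eq_or_ne (j + 1) i with hji2 | hji2
        · rw [hji2, hr'i, hoff j hji hji1, huprev (by omega)]
          rw [show i - 1 = j by omega]
        · rw [hoff j hji hji1, hoff (j + 1) hji2 (by omega)]
          exact hrD.2 j hj hjm
    have h5 := hmax r' hr'D
    have h6 : altQuad A S r' = altQuad A S r :=
      altQuad_pair h1 h2 S heq (by rw [hr'i, hr'i1]) hoff
    have h7 : φ u < φ (r i) := by
      simp only [hφ]
      have e1 : u ^ α ≤ r i ^ α := Real.rpow_le_rpow hu0 hui.le hα.le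
      have e2 : u ^ β < r i ^ β := pow_lt_pow_left₀ hui hu0 hβ0
      nlinarith
    have h8 : ∑ j ∈ A, φ (r' j) < ∑ j ∈ A, φ (r j) := by
      refine Finset.sum_lt_sum (fun j _ => ?_) ⟨i, Finset.mem_Icc.2 ⟨h1, h2.le⟩, by rwa [hr'i]⟩
      rcases eq_or_ne j i with rfl | hji
      · rw [hr'i]; exact h7.le
      rcases eq_or_ne j (i + 1) with rfl | hji1
      · rw [hr'i1, ← heq]; exact h7.le
      rw [hoff j hji hji1]
    simp only [hJ] at h5
    linarith
  -- value of the functional when one radius moves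
  have hupd : ∀ i ∈ A, ∀ t, J (0, Function.update r i t) =
      S t t + 2 * ∑ j ∈ A.erase i, (-1 : ℝ) ^ i * ((-1 : ℝ) ^ j * S t (r j))
        + altQuad (A.erase i) S r - (φ t + ∑ j ∈ A.erase i, φ (r j)) := by
    intro i hi t
    simp only [hJ]
    rw [altQuad_update hS r hi, sum_erase_update φ r hi]
  have hmemD : ∀ i ∈ A, ∀ t, 0 ≤ t → t ≤ M → (2 ≤ i → r (i - 1) ≤ t) →
      (i < m → t ≤ r (i + 1)) → Function.update r i t ∈ D := by
    intro i hi t ht0 htM hl hu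
    refine ⟨fun j => ?_, fun j hj hjm => ?_⟩
    · rcases eq_or_ne j i with rfl | hji
      · rw [Function.update_self]; exact ⟨ht0, htM⟩
      · rw [Function.update_of_ne hji]; exact hrD.1 j
    · rcases eq_or_ne j i with rfl | hji
      · rw [Function.update_self, Function.update_of_ne (by omega)]; exact hu hjm
      · rw [Function.update_of_ne hji]
        rcases eq_or_ne (j + 1) i with rfl | hji1
        · rw [Function.update_self]; exact hl (by omega)
        · rw [Function.update_of_ne hji1]; exact hrD.2 j hj hjm
  -- all radii are positive
  have hpos : ∀ i ∈ A, 0 < r i := by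
    by_contra hcon
    push Not at hcon
    obtain ⟨q0, hq0A, hq0⟩ := hcon
    have hex : ∃ q ∈ A, r q = 0 ∧ (q < m → 0 < r (q + 1)) := by
      have hne' : (A.filter fun q => r q = 0).Nonempty :=
        ⟨q0, Finset.mem_filter.2 ⟨hq0A, le_antisymm hq0 (hrD.1 q0).1⟩⟩
      have h1 := Finset.max'_mem _ hne'
      set q := (A.filter fun q => r q = 0).max' hne'
      have h2 := Finset.mem_filter.1 h1
      refine ⟨q, h2.1, h2.2, fun hqm => ?_⟩
      by_contra hc
      have h3 : q + 1 ∈ A.filter fun q => r q = 0 := Finset.mem_filter.2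
        ⟨Finset.mem_Icc.2 ⟨by omega, hqm⟩, le_antisymm (not_lt.1 hc) (hrD.1 _).1⟩
      have := Finset.le_max' _ _ h3
      omega
    obtain ⟨q, hqA, hq0, hqn⟩ := hex
    have hq1 : 1 ≤ q := (Finset.mem_Icc.1 hqA).1
    have hqm : q ≤ m := (Finset.mem_Icc.1 hqA).2
    have hlow : 2 ≤ q → r (q - 1) ≤ 0 := fun h =>
      (hmono (i := q - 1) (j := q) (by omega) (by omega) hqm).trans hq0.le
    have hevM : ∀ᶠ δ : ℝ in 𝓝[>] 0, δ ≤ M :=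
      (eventually_le_nhds hM0).filter_mono nhdsWithin_le_nhds
    have hevn : ∀ᶠ δ : ℝ in 𝓝[>] 0, q < m → δ ≤ r (q + 1) := by
      by_cases h : q < m
      · exact ((eventually_le_nhds (hqn h)).filter_mono nhdsWithin_le_nhds).mono fun _ h _ => h
      · exact Eventually.of_forall fun _ h' => absurd h' h
    have hself : J (0, r) = J (0, Function.update r q 0) := by
      rw [← hq0, Function.update_eq_self]
    have hle : ∀ᶠ δ : ℝ in 𝓝[>] 0, G - κ + 2 * ∑ j ∈ A.erase q, (-1 : ℝ) ^ q *
        ((-1 : ℝ) ^ j * (S δ (r j) / δ ^ α)) - δ ^ ((β : ℝ) - α) ≤ 0 := by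
      filter_upwards [hevM, hevn, self_mem_nhdsWithin] with δ hδM hδn hδ
      have hδ0 : (0 : ℝ) < δ := hδ
      have h1 := hmax _ (hmemD q hqA δ hδ0.le hδM (fun h => (hlow h).trans hδ0.le) hδn)
      rw [hself, hupd q hqA, hupd q hqA, hdiag _ hδ0.le, hdiag 0 le_rfl] at h1
      have h2 : ∑ j ∈ A.erase q, (-1 : ℝ) ^ q * ((-1 : ℝ) ^ j * S 0 (r j)) = 0 :=
        Finset.sum_eq_zero fun j _ => by rw [hS0 _ (hrD.1 j).1]; ring
      have hp : 0 < δ ^ α := by positivity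
      have h3 : ∑ j ∈ A.erase q, (-1 : ℝ) ^ q * ((-1 : ℝ) ^ j * (S δ (r j) / δ ^ α)) =
          (∑ j ∈ A.erase q, (-1 : ℝ) ^ q * ((-1 : ℝ) ^ j * S δ (r j))) / δ ^ α := by
        rw [Finset.sum_div]
        exact Finset.sum_congr rfl fun j _ => by ring
      have h4 : δ ^ ((β : ℝ) - α) = δ ^ β / δ ^ α := by
        rw [Real.rpow_sub hδ0, Real.rpow_natCast]
      rw [h2] at h1
      simp only [hφ, Real.zero_rpow hα.ne', zero_pow hβ0] at h1
      rw [h3, h4]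
      have h5 : G - κ + 2 * ((∑ j ∈ A.erase q, (-1 : ℝ) ^ q * ((-1 : ℝ) ^ j * S δ (r j))) / δ ^ α)
          - δ ^ β / δ ^ α = (G * δ ^ α + 2 * (∑ j ∈ A.erase q, (-1 : ℝ) ^ q *
            ((-1 : ℝ) ^ j * S δ (r j))) - (κ * δ ^ α + δ ^ β)) / δ ^ α := by
        field_simp
        ring
      rw [h5]
      refine div_nonpos_of_nonpos_of_nonneg ?_ hp.le
      linarith
    have hlim : Tendsto (fun δ : ℝ => G - κ + 2 * ∑ j ∈ A.erase q, (-1 : ℝ) ^ q *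
        ((-1 : ℝ) ^ j * (S δ (r j) / δ ^ α)) - δ ^ ((β : ℝ) - α)) (𝓝[>] 0)
        (𝓝 (G - κ + 2 * ∑ j ∈ A.erase q, (-1 : ℝ) ^ q * ((-1 : ℝ) ^ j * 0) - 0)) := by
      refine Tendsto.sub (tendsto_const_nhds.add (tendsto_const_nhds.mul
        (tendsto_finsetSum _ fun j _ => tendsto_const_nhds.mul (tendsto_const_nhds.mul
          (hsmall _ (hrD.1 j).1))))) ?_
      have : ContinuousAt (fun δ : ℝ => δ ^ ((β : ℝ) - α)) 0 :=
        Real.continuousAt_rpow_const _ _ (Or.inr (by linarith))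
      have h := this.tendsto
      rw [Real.zero_rpow (by linarith)] at h
      exact h.mono_left nhdsWithin_le_nhds
    have := le_of_tendsto hlim hle
    simp at this
    linarith
  have hstrict : ∀ i, 1 ≤ i → i < m → r i < r (i + 1) := fun i h1 h2 =>
    hne i h1 h2 (hpos i (Finset.mem_Icc.2 ⟨h1, h2.le⟩))
  refine ⟨r, hpos 1 (Finset.mem_Icc.2 ⟨le_rfl, hm⟩), hstrict, fun i hi => ?_⟩
  have hi1 : 1 ≤ i := (Finset.mem_Icc.1 hi).1
  have him : i ≤ m := (Finset.mem_Icc.1 hi).2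
  have hri := hpos i hi
  have hlocal : IsLocalMax (fun t => J (0, Function.update r i t)) (r i) := by
    have e1 : ∀ᶠ t in 𝓝 (r i), 2 ≤ i → r (i - 1) ≤ t := by
      by_cases h : 2 ≤ i
      · have : r (i - 1) < r i := strictMono_of_step hstrict (by omega) (by omega) him
        exact (eventually_ge_nhds this).mono fun _ h _ => h
      · exact Eventually.of_forall fun _ h' => absurd h' h
    have e2 : ∀ᶠ t in 𝓝 (r i), i < m → t ≤ r (i + 1) := by
      by_cases h : i < m
      · exact (eventually_le_nhds (hstrict i hi1 h)).mono fun _ h _ => h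
      · exact Eventually.of_forall fun _ h' => absurd h' h
    filter_upwards [e1, e2, eventually_ge_nhds hri,
      eventually_le_nhds ((hmono hi1 him le_rfl).trans_lt hlast)] with t h1 h2 h3 h4
    simp only [Function.update_eq_self]
    exact hmax _ (hmemD i hi t h3 h4 h1 h2)
  have hd : HasDerivAt (fun t => J (0, Function.update r i t))
      (G * (α * r i ^ (α - 1)) + 2 * ∑ j ∈ A.erase i, (-1 : ℝ) ^ i * ((-1 : ℝ) ^ j *
        dS (r i) (r j)) - (κ * (α * r i ^ (α - 1)) + β * r i ^ (β - 1))) (r i) := by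
    have e0 : (fun t => J (0, Function.update r i t)) =ᶠ[𝓝 (r i)] fun t =>
        G * t ^ α + 2 * ∑ j ∈ A.erase i, (-1 : ℝ) ^ i * ((-1 : ℝ) ^ j * S t (r j))
        + altQuad (A.erase i) S r - (φ t + ∑ j ∈ A.erase i, φ (r j)) := by
      filter_upwards [eventually_ge_nhds hri] with t ht
      rw [hupd i hi, hdiag t ht]
    refine HasDerivAt.congr_of_eventuallyEq ?_ e0
    have d1 : HasDerivAt (fun t : ℝ => t ^ α) (α * r i ^ (α - 1)) (r i) :=
      Real.hasDerivAt_rpow_const (Or.inl hri.ne')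
    have d2 : HasDerivAt (fun t => ∑ j ∈ A.erase i, (-1 : ℝ) ^ i * ((-1 : ℝ) ^ j * S t (r j)))
        (∑ j ∈ A.erase i, (-1 : ℝ) ^ i * ((-1 : ℝ) ^ j * dS (r i) (r j))) (r i) := by
      refine HasDerivAt.fun_sum fun j hj => HasDerivAt.const_mul _ (HasDerivAt.const_mul _ ?_)
      have hjA := Finset.mem_of_mem_erase hj
      have hji := Finset.ne_of_mem_erase hj
      refine hder _ _ hri (hpos j hjA) ?_
      rcases lt_or_gt_of_ne hji with h | h
      · exact (strictMono_of_step hstrict (Finset.mem_Icc.1 hjA).1 h him).ne'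
      · exact (strictMono_of_step hstrict hi1 h (Finset.mem_Icc.1 hjA).2).ne
    have d3 : HasDerivAt φ (κ * (α * r i ^ (α - 1)) + β * r i ^ (β - 1)) (r i) :=
      (d1.const_mul κ).add (hasDerivAt_pow β (r i))
    exact (((d1.const_mul G).add (d2.const_mul 2)).add_const _).sub (d3.add_const _)
  have := hlocal.hasDerivAt_eq_zero hd
  linarith

/-- The area of the unit sphere of `ℝⁿ`. -/
noncomputable def sphereArea (n : ℕ) : ℝ :=
  n * (volume : Measure (EuclideanSpace ℝ (Fin n))).real (ball 0 1)

lemma sphereArea_pos (n : ℕ) [NeZero n] : 0 < sphereArea n := by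
  have hn : (0 : ℝ) < n := Nat.cast_pos.2 (NeZero.pos n)
  refine mul_pos hn ?_
  exact ENNReal.toReal_pos (measure_ball_pos _ _ one_pos).ne' measure_ball_lt_top.ne

lemma integral_norm_eq {n : ℕ} [NeZero n] (f : ℝ → ℝ) :
    ∫ x : EuclideanSpace ℝ (Fin n), f ‖x‖ =
      sphereArea n * ∫ ρ in Ioi (0 : ℝ), ρ ^ (n - 1) * f ρ := by
  have h := integral_fun_norm_addHaar (volume : Measure (EuclideanSpace ℝ (Fin n))) f
  rw [h]
  simp [sphereArea, mul_assoc]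

lemma setIntegral_norm_eq {n : ℕ} [NeZero n] {I : Set ℝ} (hI : MeasurableSet I) (f : ℝ → ℝ) :
    ∫ x in {x : EuclideanSpace ℝ (Fin n) | ‖x‖ ∈ I}, f ‖x‖ =
      sphereArea n * ∫ ρ in Ioi 0 ∩ I, ρ ^ (n - 1) * f ρ := by
  have hm : MeasurableSet {x : EuclideanSpace ℝ (Fin n) | ‖x‖ ∈ I} := measurable_norm hI
  rw [← integral_indicator hm, ← setIntegral_indicator hI]
  have := integral_norm_eq (n := n) (I.indicator f)
  rw [show (fun x : EuclideanSpace ℝ (Fin n) => I.indicator f ‖x‖) =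
    {x : EuclideanSpace ℝ (Fin n) | ‖x‖ ∈ I}.indicator fun x => f ‖x‖ from rfl] at this
  rw [this]
  congr 1
  refine setIntegral_congr_fun measurableSet_Ioi fun ρ _ => ?_
  by_cases h : ρ ∈ I <;> simp [h]

lemma setIntegral_ball_norm {n : ℕ} [NeZero n] {a : ℝ} (ha : 0 ≤ a) (f : ℝ → ℝ) :
    ∫ x in ball (0 : EuclideanSpace ℝ (Fin n)) a, f ‖x‖ =
      sphereArea n * ∫ ρ in (0 : ℝ)..a, ρ ^ (n - 1) * f ρ := by
  have h : ball (0 : EuclideanSpace ℝ (Fin n)) a = {x | ‖x‖ ∈ Iio a} := by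
    ext x; simp
  rw [h, setIntegral_norm_eq measurableSet_Iio, intervalIntegral.integral_of_le ha,
    integral_Ioc_eq_integral_Ioo, Ioi_inter_Iio]

lemma setIntegral_shell_norm {n : ℕ} [NeZero n] {a b : ℝ} (ha : 0 < a) (hab : a ≤ b)
    (f : ℝ → ℝ) :
    ∫ x in ball (0 : EuclideanSpace ℝ (Fin n)) b \ ball 0 a, f ‖x‖ =
      sphereArea n * ∫ ρ in a..b, ρ ^ (n - 1) * f ρ := by
  have h : ball (0 : EuclideanSpace ℝ (Fin n)) b \ ball 0 a = {x | ‖x‖ ∈ Ico a b} := by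
    ext x; simp [and_comm]
  have h2 : Ioi 0 ∩ Ico a b = Ico a b := inter_eq_right.2 fun x hx => ha.trans_le hx.1
  rw [h, setIntegral_norm_eq measurableSet_Ico, intervalIntegral.integral_of_le hab, h2,
    integral_Ico_eq_integral_Ioo, integral_Ioc_eq_integral_Ioo]

lemma kernel_radial_eqOn {n : ℕ} [NeZero n] (s : ℝ) {ρ : ℝ} (hρ : 0 < ρ) :
    ρ ^ (n - 1) * ρ ^ (-((n : ℝ) + s)) = ρ ^ (-1 - s) := by
  rw [← Real.rpow_natCast, ← Real.rpow_add hρ, Nat.cast_sub (NeZero.pos n)]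
  congr 1
  push_cast
  ring

lemma integrableOn_kernel {n : ℕ} [NeZero n] {s δ : ℝ} (hs : 0 < s) (hδ : 0 < δ) :
    IntegrableOn (fun h : EuclideanSpace ℝ (Fin n) => ‖h‖ ^ (-((n : ℝ) + s))) {h | δ ≤ ‖h‖} := by
  have hm : MeasurableSet {h : EuclideanSpace ℝ (Fin n) | δ ≤ ‖h‖} :=
    measurableSet_le measurable_const measurable_norm
  rw [← integrable_indicator_iff hm]
  have h := (integrable_fun_norm_addHaar (volume : Measure (EuclideanSpace ℝ (Fin n)))
    (f := (Ici δ).indicator fun ρ => ρ ^ (-((n : ℝ) + s)))).2 ?_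
  · exact h
  have h1 : IntegrableOn (fun ρ : ℝ => ρ ^ (-1 - s)) (Ici δ) :=
    (integrableOn_Ici_iff_integrableOn_Ioi).2 (integrableOn_Ioi_rpow_of_lt (by linarith) hδ)
  rw [← integrable_indicator_iff measurableSet_Ici] at h1
  refine (h1.integrableOn (s := Ioi 0)).congr_fun (fun ρ hρ => ?_) measurableSet_Ioi
  by_cases h : ρ ∈ Ici δ
  · simp only [h, indicator_of_mem, finrank_euclideanSpace, Fintype.card_fin, smul_eq_mul]
    rw [kernel_radial_eqOn s hρ]
  · simp [h]

lemma setIntegral_kernel {n : ℕ} [NeZero n] {s δ : ℝ} (hs : 0 < s) (hδ : 0 < δ) :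
    ∫ h in {h : EuclideanSpace ℝ (Fin n) | δ ≤ ‖h‖}, ‖h‖ ^ (-((n : ℝ) + s)) =
      sphereArea n / s * δ ^ (-s) := by
  have h := setIntegral_norm_eq (n := n) (measurableSet_Ici (a := δ))
    (fun ρ => ρ ^ (-((n : ℝ) + s)))
  have h2 : Ioi 0 ∩ Ici δ = Ici δ := inter_eq_right.2 fun x hx => hδ.trans_le hx
  rw [show {h : EuclideanSpace ℝ (Fin n) | δ ≤ ‖h‖} = {h | ‖h‖ ∈ Ici δ} from rfl, h, h2,
    integral_Ici_eq_integral_Ioi, setIntegral_congr_fun (g := fun ρ : ℝ => ρ ^ (-1 - s))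
      measurableSet_Ioi (fun ρ hρ => kernel_radial_eqOn s (hδ.trans hρ)),
    integral_Ioi_rpow_of_lt (by linarith) hδ]
  rw [show -1 - s + 1 = -s by ring, neg_div_neg_eq]
  ring

/-- The potential of `S` at `x` for the kernel `|x-y|^{-(n+s)}`. -/
noncomputable def fracPot {n : ℕ} (s : ℝ) (S : Set (EuclideanSpace ℝ (Fin n)))
    (x : EuclideanSpace ℝ (Fin n)) : ℝ :=
  ∫ y in S, ‖x - y‖ ^ (-((n : ℝ) + s))

lemma measurable_kernel {n : ℕ} (s : ℝ) (x : EuclideanSpace ℝ (Fin n)) :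
    Measurable fun y : EuclideanSpace ℝ (Fin n) => ‖x - y‖ ^ (-((n : ℝ) + s)) := by
  fun_prop

lemma setIntegral_sub_left {n : ℕ} (f : EuclideanSpace ℝ (Fin n) → ℝ)
    (S : Set (EuclideanSpace ℝ (Fin n))) (x : EuclideanSpace ℝ (Fin n)) :
    ∫ y in {y | x - y ∈ S}, f (x - y) = ∫ h in S, f h := by
  have := (Measure.measurePreserving_sub_left volume x).setIntegral_preimage_emb
    (MeasurableEquiv.subLeft x).measurableEmbedding f S
  exact this

lemma setIntegral_add_left {n : ℕ} (f : EuclideanSpace ℝ (Fin n) → ℝ)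
    (S : Set (EuclideanSpace ℝ (Fin n))) (x : EuclideanSpace ℝ (Fin n)) :
    ∫ y in {y | x + y ∈ S}, f (x + y) = ∫ h in S, f h :=
  (measurePreserving_add_left volume x).setIntegral_preimage_emb
    (measurableEmbedding_addLeft x) f S

lemma integrableOn_sub_left {n : ℕ} {f : EuclideanSpace ℝ (Fin n) → ℝ}
    {S : Set (EuclideanSpace ℝ (Fin n))} (hf : IntegrableOn f S) (x : EuclideanSpace ℝ (Fin n)) :
    IntegrableOn (fun y => f (x - y)) {y | x - y ∈ S} :=
  ((Measure.measurePreserving_sub_left volume x).integrableOn_comp_preimage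
    (MeasurableEquiv.subLeft x).measurableEmbedding).2 hf

lemma integrableOn_kernel_sub {n : ℕ} [NeZero n] {s δ : ℝ} (hs : 0 < s) (hδ : 0 < δ)
    (x : EuclideanSpace ℝ (Fin n)) :
    IntegrableOn (fun y => ‖x - y‖ ^ (-((n : ℝ) + s))) {y | δ ≤ ‖x - y‖} :=
  integrableOn_sub_left (integrableOn_kernel hs hδ) x

lemma fracPot_nonneg {n : ℕ} (s : ℝ) (S : Set (EuclideanSpace ℝ (Fin n)))
    (x : EuclideanSpace ℝ (Fin n)) : 0 ≤ fracPot s S x :=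
  integral_nonneg fun _ => by positivity

lemma fracPot_le {n : ℕ} [NeZero n] {s δ : ℝ} (hs : 0 < s) (hδ : 0 < δ)
    {S : Set (EuclideanSpace ℝ (Fin n))} {x : EuclideanSpace ℝ (Fin n)}
    (hS : ∀ y ∈ S, δ ≤ ‖x - y‖) : fracPot s S x ≤ sphereArea n / s * δ ^ (-s) := by
  rw [← setIntegral_kernel hs hδ, ← setIntegral_sub_left _ _ x]
  refine setIntegral_mono_set (integrableOn_kernel_sub hs hδ x)
    (Eventually.of_forall fun _ => by positivity) (Eventually.of_forall hS)

lemma fracPot_isometry {n : ℕ} (s : ℝ) (L : EuclideanSpace ℝ (Fin n) ≃ₗᵢ[ℝ] EuclideanSpace ℝ (Fin n))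
    (S : Set (EuclideanSpace ℝ (Fin n))) (x : EuclideanSpace ℝ (Fin n)) :
    fracPot s (L ⁻¹' S) x = fracPot s S (L x) := by
  unfold fracPot
  rw [← L.measurePreserving.setIntegral_preimage_emb L.toHomeomorph.measurableEmbedding
    (fun y => ‖L x - y‖ ^ (-((n : ℝ) + s)))]
  simp only [← map_sub, L.norm_map]

open scoped Pointwise in
lemma fracPot_smul {n : ℕ} (s : ℝ) {t : ℝ} (ht : 0 < t) (S : Set (EuclideanSpace ℝ (Fin n)))
    (x : EuclideanSpace ℝ (Fin n)) :
    fracPot s {y | t • y ∈ S} x = t ^ s * fracPot s S (t • x) := by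
  unfold fracPot
  have h := Measure.setIntegral_comp_smul_of_pos volume
    (fun y : EuclideanSpace ℝ (Fin n) => ‖t • x - y‖ ^ (-((n : ℝ) + s))) {y | t • y ∈ S} ht
  have h2 : t • {y : EuclideanSpace ℝ (Fin n) | t • y ∈ S} = S := by
    ext y
    rw [mem_smul_set_iff_inv_smul_mem₀ ht.ne', mem_ofPred_eq, smul_inv_smul₀ ht.ne']
  rw [h2] at h
  simp only [← smul_sub, norm_smul, Real.norm_of_nonneg ht.le,
    Real.mul_rpow ht.le (norm_nonneg _), integral_const_mul, finrank_euclideanSpace,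
    Fintype.card_fin, smul_eq_mul] at h
  have h3 : t ^ (-((n : ℝ) + s)) * t ^ ((n : ℝ) + s) = 1 := by
    rw [← Real.rpow_add ht]; simp
  have h4 : t ^ ((n : ℝ) + s) = t ^ n * t ^ s := by
    rw [Real.rpow_add ht, Real.rpow_natCast]
  have h5 : (t : ℝ) ^ n ≠ 0 := by positivity
  calc _ = t ^ ((n : ℝ) + s) * (t ^ (-((n : ℝ) + s)) * ∫ y in {y | t • y ∈ S},
          ‖x - y‖ ^ (-((n : ℝ) + s))) := by rw [← mul_assoc, mul_comm (t ^ _), h3, one_mul]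
    _ = _ := by rw [h, h4]; field_simp

lemma exists_isometry_map_eq {n : ℕ} {x y : EuclideanSpace ℝ (Fin n)} (h : ‖x‖ = ‖y‖) :
    ∃ L : EuclideanSpace ℝ (Fin n) ≃ₗᵢ[ℝ] EuclideanSpace ℝ (Fin n), L x = y :=
  ⟨_, Submodule.reflection_sub h⟩

lemma fracPot_ball_congr {n : ℕ} (s a : ℝ) {x y : EuclideanSpace ℝ (Fin n)} (h : ‖x‖ = ‖y‖) :
    fracPot s (ball 0 a) x = fracPot s (ball 0 a) y := by
  obtain ⟨L, rfl⟩ := exists_isometry_map_eq h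
  rw [← fracPot_isometry, L.preimage_ball]
  simp

lemma fracPot_compl_ball_congr {n : ℕ} (s a : ℝ) {x y : EuclideanSpace ℝ (Fin n)}
    (h : ‖x‖ = ‖y‖) : fracPot s (ball 0 a)ᶜ x = fracPot s (ball 0 a)ᶜ y := by
  obtain ⟨L, rfl⟩ := exists_isometry_map_eq h
  rw [← fracPot_isometry, preimage_compl, L.preimage_ball]
  simp

lemma continuousAt_fracPot {n : ℕ} [NeZero n] {s δ : ℝ} (hs : 0 < s) (hδ : 0 < δ)
    {S : Set (EuclideanSpace ℝ (Fin n))} (hSm : MeasurableSet S) {x₀ : EuclideanSpace ℝ (Fin n)}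
    (hS : ∀ y ∈ S, δ ≤ ‖x₀ - y‖) : ContinuousAt (fracPot s S) x₀ := by
  have hp : 0 ≤ (n : ℝ) + s := by positivity
  refine continuousAt_of_dominated
    (bound := fun y => 2 ^ ((n : ℝ) + s) * ‖x₀ - y‖ ^ (-((n : ℝ) + s)))
    (Eventually.of_forall fun x => (measurable_kernel s x).aestronglyMeasurable) ?_ ?_ ?_
  · filter_upwards [ball_mem_nhds x₀ (half_pos hδ)] with x hx
    filter_upwards [ae_restrict_mem hSm] with y hy
    have h1 := hS y hy
    have h2 : ‖x₀ - y‖ / 2 ≤ ‖x - y‖ := by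
      have h3 : ‖x₀ - x‖ < δ / 2 := by rwa [← dist_eq_norm, dist_comm]
      have h4 := norm_sub_le_norm_sub_add_norm_sub x₀ x y
      linarith
    rw [Real.norm_of_nonneg (by positivity)]
    calc ‖x - y‖ ^ (-((n : ℝ) + s)) ≤ (‖x₀ - y‖ / 2) ^ (-((n : ℝ) + s)) :=
          Real.rpow_le_rpow_of_nonpos (by linarith) h2 (by linarith)
      _ = _ := by
          rw [div_eq_inv_mul, Real.mul_rpow (by norm_num) (norm_nonneg _),
            Real.inv_rpow (by norm_num), Real.rpow_neg (by norm_num) (_ + _), inv_inv]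
  · exact ((integrableOn_kernel_sub hs hδ x₀).mono_set hS).const_mul _
  · filter_upwards [ae_restrict_mem hSm] with y hy
    refine ContinuousAt.rpow_const (by fun_prop) (Or.inl ?_)
    exact (hδ.trans_le (hS y hy)).ne'

/-- A unit vector of `ℝⁿ`. -/
noncomputable def baseVec (n : ℕ) [NeZero n] : EuclideanSpace ℝ (Fin n) :=
  EuclideanSpace.single 0 1

lemma norm_baseVec (n : ℕ) [NeZero n] : ‖baseVec n‖ = 1 := by
  simp [baseVec]

lemma norm_smul_baseVec {n : ℕ} [NeZero n] {a : ℝ} (ha : 0 ≤ a) : ‖a • baseVec n‖ = a := by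
  rw [norm_smul, norm_baseVec, mul_one, Real.norm_of_nonneg ha]

/-- The potential of the complement of `B_b` at distance `a` from the origin. -/
noncomputable def outerPot (n : ℕ) [NeZero n] (s a b : ℝ) : ℝ :=
  fracPot s (ball 0 b)ᶜ (a • baseVec n)

/-- The potential of `B_a` at distance `b` from the origin. -/
noncomputable def innerPot (n : ℕ) [NeZero n] (s b a : ℝ) : ℝ :=
  fracPot s (ball 0 a) (b • baseVec n)

lemma fracPot_compl_ball_eq {n : ℕ} [NeZero n] (s b : ℝ) (x : EuclideanSpace ℝ (Fin n)) :
    fracPot s (ball 0 b)ᶜ x = outerPot n s ‖x‖ b :=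
  fracPot_compl_ball_congr s b (norm_smul_baseVec (norm_nonneg x)).symm

lemma fracPot_ball_eq {n : ℕ} [NeZero n] (s a : ℝ) (x : EuclideanSpace ℝ (Fin n)) :
    fracPot s (ball 0 a) x = innerPot n s ‖x‖ a :=
  fracPot_ball_congr s a (norm_smul_baseVec (norm_nonneg x)).symm

lemma smul_mem_ball_iff {n : ℕ} {t : ℝ} (ht : 0 < t) (a : ℝ) (y : EuclideanSpace ℝ (Fin n)) :
    t • y ∈ ball (0 : EuclideanSpace ℝ (Fin n)) (t * a) ↔ y ∈ ball 0 a := by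
  rw [mem_ball_zero_iff, mem_ball_zero_iff, norm_smul, Real.norm_of_nonneg ht.le,
    mul_lt_mul_iff_right₀ ht]

lemma outerPot_smul {n : ℕ} [NeZero n] (s : ℝ) {t : ℝ} (ht : 0 < t) (a b : ℝ) :
    outerPot n s (t * a) (t * b) = t ^ (-s) * outerPot n s a b := by
  have h := fracPot_smul s ht (ball 0 (t * b))ᶜ (a • baseVec n)
  simp only [mem_compl_iff, smul_mem_ball_iff ht] at h
  unfold outerPot
  rw [mul_smul, show (ball (0 : EuclideanSpace ℝ (Fin n)) b)ᶜ = {y | y ∉ ball 0 b} from rfl, h,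
    ← mul_assoc, ← Real.rpow_add ht]
  simp

lemma innerPot_smul {n : ℕ} [NeZero n] (s : ℝ) {t : ℝ} (ht : 0 < t) (b a : ℝ) :
    innerPot n s (t * b) (t * a) = t ^ (-s) * innerPot n s b a := by
  have h := fracPot_smul s ht (ball 0 (t * a)) (b • baseVec n)
  simp only [smul_mem_ball_iff ht] at h
  unfold innerPot
  rw [mul_smul, show (ball (0 : EuclideanSpace ℝ (Fin n)) a) = {y | y ∈ ball 0 a} from rfl, h,
    ← mul_assoc, ← Real.rpow_add ht]
  simp

lemma outerPot_nonneg (n : ℕ) [NeZero n] (s a b : ℝ) : 0 ≤ outerPot n s a b :=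
  fracPot_nonneg _ _ _

lemma le_norm_sub_of_notMem_ball {n : ℕ} {b : ℝ} {x y : EuclideanSpace ℝ (Fin n)}
    (hy : y ∈ (ball (0 : EuclideanSpace ℝ (Fin n)) b)ᶜ) : b - ‖x‖ ≤ ‖x - y‖ := by
  rw [mem_compl_iff, mem_ball_zero_iff, not_lt] at hy
  have := norm_sub_norm_le y x
  rw [norm_sub_rev] at this
  linarith

lemma le_norm_sub_of_mem_ball {n : ℕ} {a : ℝ} {x y : EuclideanSpace ℝ (Fin n)}
    (hy : y ∈ ball (0 : EuclideanSpace ℝ (Fin n)) a) : ‖x‖ - a ≤ ‖x - y‖ := by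
  rw [mem_ball_zero_iff] at hy
  have := norm_sub_norm_le x y
  linarith

lemma outerPot_le {n : ℕ} [NeZero n] {s a b : ℝ} (hs : 0 < s) (ha : 0 ≤ a) (hab : a < b) :
    outerPot n s a b ≤ sphereArea n / s * (b - a) ^ (-s) := by
  refine fracPot_le hs (by linarith) fun y hy => ?_
  have := le_norm_sub_of_notMem_ball (x := a • baseVec n) hy
  rwa [norm_smul_baseVec ha] at this

lemma continuousAt_outerPot {n : ℕ} [NeZero n] {s a b : ℝ} (hs : 0 < s) (ha : 0 ≤ a)
    (hab : a < b) : ContinuousAt (fun a => outerPot n s a b) a := by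
  refine ContinuousAt.comp (f := fun a : ℝ => a • baseVec n) (g := fracPot s (ball 0 b)ᶜ)
    (continuousAt_fracPot hs (sub_pos.2 hab) measurableSet_ball.compl fun y hy => ?_) (by fun_prop)
  have := le_norm_sub_of_notMem_ball (x := a • baseVec n) hy
  rwa [norm_smul_baseVec ha] at this

lemma continuousAt_innerPot {n : ℕ} [NeZero n] {s a b : ℝ} (hs : 0 < s) (ha : 0 ≤ a)
    (hab : a < b) : ContinuousAt (fun b => innerPot n s b a) b := by
  refine ContinuousAt.comp (f := fun b : ℝ => b • baseVec n) (g := fracPot s (ball 0 a))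
    (continuousAt_fracPot hs (sub_pos.2 hab) measurableSet_ball fun y hy => ?_) (by fun_prop)
  have := le_norm_sub_of_mem_ball (x := b • baseVec n) hy
  rwa [norm_smul_baseVec (by linarith)] at this

/-- The interaction energy of `B_a` and the complement of `B_b`, up to a constant factor. -/
noncomputable def interaction (n : ℕ) [NeZero n] (s a b : ℝ) : ℝ :=
  ∫ ρ in (0 : ℝ)..a, ρ ^ (n - 1) * outerPot n s ρ b

lemma intervalIntegrable_outerPot {n : ℕ} [NeZero n] {s b : ℝ} (hs : s ∈ Ioo (0 : ℝ) 1)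
    (hb : 0 < b) : IntervalIntegrable (fun ρ => ρ ^ (n - 1) * outerPot n s ρ b) volume 0 b := by
  have h1 : IntervalIntegrable (fun ρ : ℝ => b ^ (n - 1) * (sphereArea n / s * (b - ρ) ^ (-s)))
      volume 0 b := by
    refine IntervalIntegrable.const_mul (IntervalIntegrable.const_mul ?_ _) _
    have := (intervalIntegral.intervalIntegrable_rpow' (a := 0) (b := b) (r := -s)
      (by linarith [hs.2])).comp_sub_left b
    simpa using this.symm
  rw [intervalIntegrable_iff_integrableOn_Ioo_of_le hb.le] at h1 ⊢
  refine Integrable.mono' h1 ?_ ?_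
  · refine ContinuousOn.aestronglyMeasurable (fun ρ hρ => ?_) measurableSet_Ioo
    exact ((continuousAt_id.pow _).mul
      (continuousAt_outerPot hs.1 hρ.1.le hρ.2)).continuousWithinAt
  · filter_upwards [ae_restrict_mem measurableSet_Ioo] with ρ hρ
    rw [Real.norm_of_nonneg (mul_nonneg (pow_nonneg hρ.1.le _) (outerPot_nonneg _ _ _ _))]
    exact mul_le_mul (pow_le_pow_left₀ hρ.1.le hρ.2.le _) (outerPot_le hs.1 hρ.1.le hρ.2)
      (outerPot_nonneg _ _ _ _) (by positivity)

lemma intervalIntegrable_outerPot' {n : ℕ} [NeZero n] {s a b : ℝ} (hs : s ∈ Ioo (0 : ℝ) 1)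
    (ha : 0 ≤ a) (hab : a ≤ b) (hb : 0 < b) :
    IntervalIntegrable (fun ρ => ρ ^ (n - 1) * outerPot n s ρ b) volume 0 a := by
  refine (intervalIntegrable_outerPot hs hb).mono_set ?_
  rw [uIcc_of_le ha, uIcc_of_le (ha.trans hab)]
  exact Icc_subset_Icc le_rfl hab

lemma continuousOn_interaction {n : ℕ} [NeZero n] {s b : ℝ} (hs : s ∈ Ioo (0 : ℝ) 1)
    (hb : 0 < b) : ContinuousOn (fun a => interaction n s a b) (Icc 0 b) := by
  have h := intervalIntegral.continuousOn_primitive_interval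
    (f := fun ρ => ρ ^ (n - 1) * outerPot n s ρ b) (a := 0) (b := b) (μ := volume) ?_
  · rwa [uIcc_of_le hb.le] at h
  · rw [uIcc_of_le hb.le]
    exact (intervalIntegrable_iff_integrableOn_Icc_of_le hb.le).1 (intervalIntegrable_outerPot hs hb)

lemma hasDerivAt_interaction_left {n : ℕ} [NeZero n] {s a b : ℝ} (hs : s ∈ Ioo (0 : ℝ) 1)
    (ha : 0 < a) (hab : a < b) :
    HasDerivAt (fun a => interaction n s a b) (a ^ (n - 1) * outerPot n s a b) a := by
  have hc : ∀ ρ ∈ Ioo 0 b, ContinuousAt (fun ρ => ρ ^ (n - 1) * outerPot n s ρ b) ρ :=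
    fun ρ hρ => (continuousAt_id.pow _).mul (continuousAt_outerPot hs.1 hρ.1.le hρ.2)
  exact intervalIntegral.integral_hasDerivAt_right
    (intervalIntegrable_outerPot' hs ha.le hab.le (ha.trans hab))
    (ContinuousOn.stronglyMeasurableAtFilter isOpen_Ioo
      (fun ρ hρ => (hc ρ hρ).continuousWithinAt) a ⟨ha, hab⟩) (hc a ⟨ha, hab⟩)

lemma interaction_nonneg {n : ℕ} [NeZero n] (s : ℝ) {a : ℝ} (ha : 0 ≤ a) (b : ℝ) :
    0 ≤ interaction n s a b :=
  intervalIntegral.integral_nonneg ha fun _ hρ =>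
    mul_nonneg (pow_nonneg hρ.1 _) (outerPot_nonneg _ _ _ _)

lemma interaction_mono {n : ℕ} [NeZero n] {s a a' b : ℝ} (hs : s ∈ Ioo (0 : ℝ) 1)
    (ha : 0 ≤ a) (haa : a ≤ a') (hab : a' ≤ b) (hb : 0 < b) :
    interaction n s a b ≤ interaction n s a' b := by
  refine intervalIntegral.integral_mono_interval le_rfl ha haa ?_
    (intervalIntegrable_outerPot' hs (ha.trans haa) hab hb)
  filter_upwards [ae_restrict_mem measurableSet_Ioc] with ρ hρ
  exact mul_nonneg (pow_nonneg hρ.1.le _) (outerPot_nonneg _ _ _ _)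

lemma interaction_eq {n : ℕ} [NeZero n] (s a : ℝ) {b : ℝ} (hb : 0 < b) :
    interaction n s a b = b ^ ((n : ℝ) - s) * interaction n s (a / b) 1 := by
  unfold interaction
  have h := intervalIntegral.integral_comp_div (a := 0) (b := a)
    (fun ρ => ρ ^ (n - 1) * outerPot n s ρ 1) hb.ne'
  rw [zero_div, smul_eq_mul] at h
  have h2 : ∫ ρ in (0 : ℝ)..a, ρ ^ (n - 1) * outerPot n s ρ b =
      b ^ ((n : ℝ) - 1 - s) * ∫ ρ in (0 : ℝ)..a, (ρ / b) ^ (n - 1) * outerPot n s (ρ / b) 1 := by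
    rw [← intervalIntegral.integral_const_mul]
    refine intervalIntegral.integral_congr fun ρ _ => ?_
    have e1 := outerPot_smul (n := n) s hb (ρ / b) 1
    rw [mul_div_cancel₀ _ hb.ne', mul_one] at e1
    have e2 : b ^ ((n : ℝ) - 1 - s) = b ^ (n - 1) * b ^ (-s) := by
      rw [← Real.rpow_natCast, ← Real.rpow_add hb, Nat.cast_sub (NeZero.pos n)]
      congr 1
      push_cast
      ring
    rw [e1, e2, div_pow]
    field_simp
  rw [h2, h, ← mul_assoc]
  congr 1
  rw [← Real.rpow_add_one hb.ne']
  congr 1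
  ring

lemma interaction_sub {n : ℕ} [NeZero n] {s a b c : ℝ} (hs : s ∈ Ioo (0 : ℝ) 1)
    (ha : 0 < a) (hab : a < b) (hbc : b ≤ c) :
    interaction n s a b - interaction n s a c = ∫ σ in b..c, σ ^ (n - 1) * innerPot n s σ a := by
  have hb : 0 < b := ha.trans hab
  have hV := sphereArea_pos n
  refine mul_left_cancel₀ hV.ne' ?_
  set T : Set (EuclideanSpace ℝ (Fin n)) := ball 0 c \ ball 0 b with hT
  have hTm : MeasurableSet T := measurableSet_ball.diff measurableSet_ball
  have hsub : ball (0 : EuclideanSpace ℝ (Fin n)) b ⊆ ball 0 c := ball_subset_ball hbc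
  have h1 : sphereArea n * (interaction n s a b - interaction n s a c) =
      ∫ x in ball (0 : EuclideanSpace ℝ (Fin n)) a, fracPot s T x := by
    unfold interaction
    rw [← intervalIntegral.integral_sub (intervalIntegrable_outerPot' hs ha.le hab.le hb)
      (intervalIntegrable_outerPot' hs ha.le (hab.le.trans hbc) (hb.trans_le hbc))]
    simp only [← mul_sub]
    rw [← setIntegral_ball_norm ha.le fun ρ => outerPot n s ρ b - outerPot n s ρ c]
    refine setIntegral_congr_fun measurableSet_ball fun x hx => ?_
    rw [← fracPot_compl_ball_eq, ← fracPot_compl_ball_eq]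
    have hx' : ‖x‖ < a := by simpa using hx
    have hfi : IntegrableOn (fun y => ‖x - y‖ ^ (-((n : ℝ) + s)))
        (ball (0 : EuclideanSpace ℝ (Fin n)) b)ᶜ :=
      (integrableOn_kernel_sub hs.1 (δ := b - ‖x‖) (by linarith) x).mono_set
        fun y hy => le_norm_sub_of_notMem_ball hy
    have hd : (ball (0 : EuclideanSpace ℝ (Fin n)) b)ᶜ = (ball 0 c)ᶜ ∪ T := by
      ext y
      have := @hsub y
      simp only [hT, mem_compl_iff, mem_union, Set.mem_sdiff]
      tauto
    have hdis : Disjoint (ball (0 : EuclideanSpace ℝ (Fin n)) c)ᶜ T :=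
      disjoint_left.2 fun y hy hy' => hy hy'.1
    unfold fracPot
    rw [hd] at hfi ⊢
    rw [setIntegral_union hdis hTm (hfi.mono_set subset_union_left)
      (hfi.mono_set subset_union_right)]
    ring
  have h2 : sphereArea n * ∫ σ in b..c, σ ^ (n - 1) * innerPot n s σ a =
      ∫ y in T, fracPot s (ball 0 a) y := by
    rw [← setIntegral_shell_norm hb hbc fun σ => innerPot n s σ a]
    simp only [fracPot_ball_eq]
    rfl
  rw [h1, h2]
  unfold fracPot
  rw [integral_integral_swap]
  · refine setIntegral_congr_fun hTm fun y _ => ?_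
    simp only [norm_sub_rev y]
  · have hfin : IsFiniteMeasure (volume.restrict (ball (0 : EuclideanSpace ℝ (Fin n)) a)) :=
      ⟨by simpa using measure_ball_lt_top⟩
    have hfin2 : IsFiniteMeasure (volume.restrict T) :=
      ⟨by simpa using (measure_mono sdiff_subset).trans_lt (measure_ball_lt_top (x := 0) (r := c))⟩
    refine Integrable.of_bound (C := (b - a) ^ (-((n : ℝ) + s)))
      (Measurable.aestronglyMeasurable (by unfold Function.uncurry; fun_prop)) ?_
    rw [Measure.prod_restrict]
    filter_upwards [ae_restrict_mem (measurableSet_ball.prod hTm)] with p hp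
    have hp1 : ‖p.1‖ < a := by simpa using hp.1
    have hp2 := le_norm_sub_of_notMem_ball (x := p.1) (hp.2.2 : p.2 ∈ (ball 0 b)ᶜ)
    have hns : (0 : ℝ) ≤ n + s := by have := hs.1; positivity
    rw [Function.uncurry, Real.norm_of_nonneg (by positivity)]
    exact Real.rpow_le_rpow_of_nonpos (by linarith) (by linarith) (by linarith)

lemma hasDerivAt_interaction_right {n : ℕ} [NeZero n] {s a b : ℝ} (hs : s ∈ Ioo (0 : ℝ) 1)
    (ha : 0 < a) (hab : a < b) :
    HasDerivAt (fun b => interaction n s a b) (-(b ^ (n - 1) * innerPot n s b a)) b := by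
  obtain ⟨c, hac, hcb⟩ := exists_between hab
  have hc : ∀ σ ∈ Ioi a, ContinuousAt (fun σ => σ ^ (n - 1) * innerPot n s σ a) σ :=
    fun σ hσ => (continuousAt_id.pow _).mul (continuousAt_innerPot hs.1 ha.le hσ)
  have h := (intervalIntegral.integral_hasDerivAt_right (a := c) (b := b)
    (f := fun σ => σ ^ (n - 1) * innerPot n s σ a) ?_
    (ContinuousOn.stronglyMeasurableAtFilter isOpen_Ioi
      (fun σ hσ => (hc σ hσ).continuousWithinAt) b hab) (hc b hab)).const_sub (interaction n s a c)
  · refine h.congr_of_eventuallyEq ?_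
    filter_upwards [eventually_ge_nhds hcb] with t ht
    rw [← interaction_sub hs ha hac ht]
    ring
  · refine ContinuousOn.intervalIntegrable fun σ hσ => (hc σ ?_).continuousWithinAt
    rw [uIcc_of_le hcb.le] at hσ
    exact hac.trans_le hσ.1

/-- Euler's identity for the homogeneous function `interaction`. -/
lemma interaction_euler {n : ℕ} [NeZero n] {s t : ℝ} (hs : s ∈ Ioo (0 : ℝ) 1)
    (ht : t ∈ Ioo (0 : ℝ) 1) :
    ((n : ℝ) - s) * interaction n s t 1 = t ^ n * outerPot n s t 1 - innerPot n s 1 t := by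
  have h1 := hasDerivAt_interaction_right (n := n) hs ht.1 ht.2
  have h2 : HasDerivAt (fun b : ℝ => b ^ ((n : ℝ) - s) * interaction n s (t / b) 1)
      (((n : ℝ) - s) * 1 ^ ((n : ℝ) - s - 1) * interaction n s (t / 1) 1 +
        1 ^ ((n : ℝ) - s) * (t ^ (n - 1) * outerPot n s t 1 * (-t))) 1 := by
    refine (Real.hasDerivAt_rpow_const (Or.inl one_ne_zero)).mul ?_
    have h3 : HasDerivAt (fun b : ℝ => t / b) (-t) 1 := by
      simpa [div_eq_mul_inv] using (hasDerivAt_inv (one_ne_zero (α := ℝ))).const_mul t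
    have h4 := hasDerivAt_interaction_left (n := n) hs ht.1 ht.2
    rw [show t = t / 1 by simp] at h4
    have h5 := HasDerivAt.comp (1 : ℝ) h4 h3
    rw [div_one] at h5
    exact h5
  have h5 : (fun b => interaction n s t b) =ᶠ[𝓝 1]
      fun b : ℝ => b ^ ((n : ℝ) - s) * interaction n s (t / b) 1 := by
    filter_upwards [eventually_gt_nhds (zero_lt_one (α := ℝ))] with b hb
    exact interaction_eq s t hb
  have h6 := h1.unique (h2.congr_of_eventuallyEq h5)
  have h7 : t ^ n = t ^ (n - 1) * t := by
    rw [← pow_succ, Nat.sub_add_cancel (NeZero.pos n)]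
  simp only [one_pow, one_mul, Real.one_rpow, mul_one, div_one] at h6
  rw [h7]
  linarith

lemma norm_add_baseVec_sq {n : ℕ} [NeZero n] (h : EuclideanSpace ℝ (Fin n)) :
    ‖baseVec n + h‖ ^ 2 = 1 + 2 * h 0 + ‖h‖ ^ 2 := by
  rw [norm_add_sq_real, norm_baseVec]
  simp [baseVec, EuclideanSpace.inner_single_left]

lemma norm_sub_baseVec_sq {n : ℕ} [NeZero n] (h : EuclideanSpace ℝ (Fin n)) :
    ‖baseVec n - h‖ ^ 2 = 1 - 2 * h 0 + ‖h‖ ^ 2 := by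
  rw [norm_sub_sq_real, norm_baseVec]
  simp [baseVec, EuclideanSpace.inner_single_left]

lemma volume_slab_le {n : ℕ} [NeZero n] {q α β : ℝ} (hq : 0 ≤ q) (hαβ : α ≤ β)
    {S : Set (EuclideanSpace ℝ (Fin n))} (hS : ∀ h ∈ S, ‖h‖ ≤ q ∧ α ≤ h 0 ∧ h 0 ≤ β) :
    volume S < ⊤ ∧ volume.real S ≤ (β - α) * (2 * q) ^ (n - 1) := by
  set lo : Fin n → ℝ := Function.update (fun _ => -q) 0 α with hlo
  set hi : Fin n → ℝ := Function.update (fun _ => q) 0 β with hhi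
  have hmp := EuclideanSpace.volume_preserving_symm_measurableEquiv_toLp (Fin n)
  have hle : lo ≤ hi := by
    intro i
    rcases eq_or_ne i 0 with rfl | hi0
    · simpa [hlo, hhi] using hαβ
    · simp only [hlo, hhi, Function.update_of_ne hi0]; linarith
  have hsub : S ⊆ (MeasurableEquiv.toLp 2 (Fin n → ℝ)).symm ⁻¹' Icc lo hi := by
    intro h hh
    obtain ⟨h1, h2, h3⟩ := hS h hh
    have h4 : ∀ i, |h i| ≤ q := fun i => by
      have := PiLp.norm_apply_le h i
      rw [Real.norm_eq_abs] at this
      exact this.trans h1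
    have h5 : ∀ i, lo i ≤ h i ∧ h i ≤ hi i := by
      intro i
      rcases eq_or_ne i 0 with rfl | hi0
      · simpa [hlo, hhi] using ⟨h2, h3⟩
      · simp only [hlo, hhi, Function.update_of_ne hi0]
        exact abs_le.1 (h4 i)
    exact ⟨fun i => (h5 i).1, fun i => (h5 i).2⟩
  have hvol := hmp.measure_preimage (measurableSet_Icc (a := lo) (b := hi)).nullMeasurableSet
  have hfin : volume ((MeasurableEquiv.toLp 2 (Fin n → ℝ)).symm ⁻¹' Icc lo hi) < ⊤ := by
    rw [hvol]; exact isCompact_Icc.measure_lt_top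
  refine ⟨(measure_mono hsub).trans_lt hfin, (measureReal_mono hsub hfin.ne).trans_eq ?_⟩
  rw [measureReal_def, hvol, Real.volume_Icc_pi_toReal hle]
  have : (fun i => hi i - lo i) = Function.update (fun _ => 2 * q) 0 (β - α) := by
    ext i
    rcases eq_or_ne i 0 with rfl | hi0
    · simp [hlo, hhi]
    · simp only [hlo, hhi, Function.update_of_ne hi0]; ring
  rw [this, Finset.prod_update_of_mem (Finset.mem_univ _), Finset.prod_const,
    Finset.card_sdiff_of_subset (by simp)]
  simp

lemma setIntegral_lens_le {n : ℕ} [NeZero n] {s t : ℝ} (hs : 0 < s) (ht : t ∈ Ico (1 / 2 : ℝ) 1) :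
    ∫ h in {h : EuclideanSpace ℝ (Fin n) | ‖baseVec n - h‖ < t ∧ ‖baseVec n + h‖ < 1 / t},
      ‖h‖ ^ (-((n : ℝ) + s)) ≤ 6 ^ (n + 1) * (1 - t) ^ (1 - s) := by
  have ht0 : 0 < t := by linarith [ht.1]
  have ht1 : t < 1 := ht.2
  have hu : 0 < 1 - t := by linarith
  have hinv : t * (1 / t) = 1 := by field_simp
  have hinv1 : 1 < 1 / t := by rw [lt_div_iff₀ ht0]; linarith
  have hinv2 : 1 / t ≤ 2 := by rw [div_le_iff₀ ht0]; linarith [ht.1]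
  set τ := 1 / t with hτ
  have hq : 0 < τ - t := by linarith
  have hq3 : τ - t ≤ 3 * (1 - t) := by nlinarith
  obtain ⟨hfin, hvol⟩ := volume_slab_le (n := n) (q := τ - t) (α := (1 - t ^ 2) / 2)
    (β := (τ ^ 2 - 1) / 2) (S := {h | ‖baseVec n - h‖ < t ∧ ‖baseVec n + h‖ < τ}) hq.le
    (by nlinarith [sq_nonneg (τ - t)]) (by
      rintro h ⟨h1, h2⟩
      have e1 := norm_sub_baseVec_sq h
      have e2 := norm_add_baseVec_sq h
      have f1 : ‖baseVec n - h‖ ^ 2 < t ^ 2 := pow_lt_pow_left₀ h1 (norm_nonneg _) two_ne_zero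
      have f2 : ‖baseVec n + h‖ ^ 2 < τ ^ 2 := pow_lt_pow_left₀ h2 (norm_nonneg _) two_ne_zero
      have f3 := sq_nonneg ‖h‖
      refine ⟨?_, by linarith, by linarith⟩
      refine abs_le_of_sq_le_sq' ?_ hq.le |>.2
      nlinarith)
  have hbound := norm_setIntegral_le_of_norm_le_const (μ := volume)
    (f := fun h : EuclideanSpace ℝ (Fin n) => ‖h‖ ^ (-((n : ℝ) + s)))
    (C := (1 - t) ^ (-((n : ℝ) + s))) hfin (by
      rintro h ⟨h1, -⟩
      rw [Real.norm_of_nonneg (by positivity)]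
      have h3 := norm_sub_norm_le (baseVec n) h
      rw [norm_baseVec] at h3
      have : (0 : ℝ) ≤ n + s := by positivity
      exact Real.rpow_le_rpow_of_nonpos hu (by linarith) (by linarith))
  refine (le_abs_self _).trans (hbound.trans ?_)
  have hpn : (0 : ℝ) ≤ (2 * (τ - t)) ^ (n - 1) := by positivity
  calc (1 - t) ^ (-((n : ℝ) + s)) * volume.real {h | ‖baseVec n - h‖ < t ∧ ‖baseVec n + h‖ < τ}
      ≤ (1 - t) ^ (-((n : ℝ) + s)) * (6 * (1 - t)) ^ (n + 1) := by
        refine mul_le_mul_of_nonneg_left (hvol.trans ?_) (by positivity)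
        calc _ ≤ (2 * (τ - t)) ^ 2 * (2 * (τ - t)) ^ (n - 1) :=
              mul_le_mul_of_nonneg_right (by nlinarith [sq_nonneg (τ - t)]) hpn
          _ = (2 * (τ - t)) ^ (n + 1) := by
              rw [← pow_add]; congr 1; have := NeZero.pos n; omega
          _ ≤ _ := pow_le_pow_left₀ (by linarith) (by linarith) _
    _ = 6 ^ (n + 1) * (1 - t) ^ (1 - s) := by
        have : (1 - t) ^ (1 - s) = (1 - t) ^ (-((n : ℝ) + s)) * (1 - t) ^ (n + 1) := by
          rw [← Real.rpow_natCast, ← Real.rpow_add hu]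
          congr 1
          push_cast
          ring
        rw [this, mul_pow]
        ring

/-- The displacements `h` for which neither `x + h` nor `x - h` is in the ball `B_{|x|}`. -/
def doubleOut {n : ℕ} (x : EuclideanSpace ℝ (Fin n)) : Set (EuclideanSpace ℝ (Fin n)) :=
  {h | ‖x‖ ≤ ‖x + h‖ ∧ ‖x‖ ≤ ‖x - h‖}

lemma measurableSet_doubleOut {n : ℕ} (x : EuclideanSpace ℝ (Fin n)) :
    MeasurableSet (doubleOut x) := by
  have h1 : MeasurableSet {h | ‖x‖ ≤ ‖x + h‖} := measurableSet_le (by fun_prop) (by fun_prop)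
  have h2 : MeasurableSet {h | ‖x‖ ≤ ‖x - h‖} := measurableSet_le (by fun_prop) (by fun_prop)
  exact h1.inter h2

/-- The fractional mean curvature of the unit ball. -/
noncomputable def ballCurv (n : ℕ) [NeZero n] (s : ℝ) : ℝ :=
  fracPot s (doubleOut (baseVec n)) 0

lemma fracPot_zero {n : ℕ} (s : ℝ) (S : Set (EuclideanSpace ℝ (Fin n))) :
    fracPot s S 0 = ∫ h in S, ‖h‖ ^ (-((n : ℝ) + s)) := by
  simp [fracPot]

lemma setIntegral_doubleOut_le {n : ℕ} [NeZero n] {s t : ℝ} (hs : s ∈ Ioo (0 : ℝ) 1)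
    (ht : t ∈ Ico (1 / 2 : ℝ) 1) :
    IntegrableOn (fun h => ‖h‖ ^ (-((n : ℝ) + s)))
      {h : EuclideanSpace ℝ (Fin n) | 1 / t ≤ ‖baseVec n + h‖} ∧
    ∫ h in doubleOut (baseVec n) ∩ {h | 1 / t ≤ ‖baseVec n + h‖}, ‖h‖ ^ (-((n : ℝ) + s)) ≤
      ((n : ℝ) - s) * interaction n s 1 1 +
        (n * (sphereArea n / s) + 6 ^ (n + 1)) * (1 - t) ^ (1 - s) := by
  have hs0 := hs.1
  have ht0 : 0 < t := by linarith [ht.1]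
  have ht1 : t < 1 := ht.2
  have hu : 0 < 1 - t := by linarith
  have hn1 : (1 : ℝ) ≤ n := by exact_mod_cast NeZero.pos n
  have hinv : t * (1 / t) = 1 := by field_simp
  have hinv1 : 1 < 1 / t := by rw [lt_div_iff₀ ht0]; linarith
  set τ := 1 / t with hτ
  set e := baseVec n with he
  have hne : ‖e‖ = 1 := norm_baseVec n
  set f : EuclideanSpace ℝ (Fin n) → ℝ := fun h => ‖h‖ ^ (-((n : ℝ) + s)) with hf
  set A : Set (EuclideanSpace ℝ (Fin n)) := {h | τ ≤ ‖e + h‖} with hA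
  set B : Set (EuclideanSpace ℝ (Fin n)) := {h | ‖e - h‖ < t} with hB
  have hAm : MeasurableSet A := measurableSet_le (by fun_prop) (by fun_prop)
  have hBm : MeasurableSet B := measurableSet_lt (by fun_prop) (by fun_prop)
  have hAi : IntegrableOn f A := by
    refine (integrableOn_kernel hs0 (δ := τ - 1) (by linarith)).mono_set fun h hh => ?_
    have h1 : τ ≤ ‖e + h‖ := hh
    have h2 := norm_add_le e h
    change τ - 1 ≤ ‖h‖
    linarith
  have hBi : IntegrableOn f B := by
    refine (integrableOn_kernel hs0 hu).mono_set fun h hh => ?_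
    have h1 : ‖e - h‖ < t := hh
    have h2 := norm_sub_norm_le e h
    change 1 - t ≤ ‖h‖
    linarith
  refine ⟨hAi, ?_⟩
  have hAe : ∫ h in A, f h = outerPot n s 1 τ := by
    have h1 := setIntegral_add_left (fun y => ‖e - y‖ ^ (-((n : ℝ) + s))) (ball 0 τ)ᶜ e
    have h2 : {y | e + y ∈ (ball (0 : EuclideanSpace ℝ (Fin n)) τ)ᶜ} = A := by
      ext y; simp [hA]
    rw [h2] at h1
    simp only [sub_add_cancel_left, norm_neg] at h1
    rw [outerPot, one_smul]
    exact h1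
  have hBe : ∫ h in B, f h = innerPot n s 1 t := by
    have h1 := setIntegral_sub_left (fun y => ‖e - y‖ ^ (-((n : ℝ) + s))) (ball 0 t) e
    have h2 : {y | e - y ∈ ball (0 : EuclideanSpace ℝ (Fin n)) t} = B := by
      ext y; simp [hB]
    rw [h2] at h1
    simp only [sub_sub_cancel] at h1
    rw [innerPot, one_smul]
    exact h1
  have hsub : doubleOut e ∩ A ⊆ A \ B := by
    rintro h ⟨h1, h2⟩
    refine ⟨h2, fun h3 => ?_⟩
    have h4 : ‖e‖ ≤ ‖e - h‖ := h1.2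
    have h5 : ‖e - h‖ < t := h3
    linarith
  have h1 : ∫ h in doubleOut e ∩ A, f h ≤ ∫ h in A \ B, f h :=
    setIntegral_mono_set (hAi.mono_set sdiff_subset)
      (Eventually.of_forall fun _ => by simp only [hf]; positivity) (Eventually.of_forall hsub)
  have h2 := integral_inter_add_sdiff hBm hAi
  have h3 := integral_inter_add_sdiff hAm hBi
  have h4 : B \ A = {h | ‖e - h‖ < t ∧ ‖e + h‖ < τ} := by
    ext h; simp [hA, hB]
  have h5 : ∫ h in B \ A, f h ≤ 6 ^ (n + 1) * (1 - t) ^ (1 - s) := by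
    rw [h4]; exact setIntegral_lens_le hs0 ht
  have h6 := interaction_euler (n := n) hs ⟨ht0, ht1⟩
  have h7 : outerPot n s t 1 = t ^ (-s) * outerPot n s 1 τ := by
    rw [← outerPot_smul s ht0, hinv, mul_one]
  have h8 : interaction n s t 1 ≤ interaction n s 1 1 :=
    interaction_mono hs ht0.le ht1.le le_rfl one_pos
  have h9 : outerPot n s 1 τ ≤ sphereArea n / s * (1 - t) ^ (-s) := by
    refine (outerPot_le hs0 zero_le_one hinv1).trans ?_
    refine mul_le_mul_of_nonneg_left ?_ (div_nonneg (sphereArea_pos n).le hs0.le)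
    exact Real.rpow_le_rpow_of_nonpos hu (by nlinarith) (by linarith)
  have h10 : 1 - t ^ n * t ^ (-s) ≤ n * (1 - t) := by
    have e1 : (1 : ℝ) ≤ t ^ (-s) := Real.one_le_rpow_of_pos_of_le_one_of_nonpos ht0 ht1.le
      (by linarith)
    have e2 := one_add_mul_le_pow (a := t - 1) (by linarith) n
    rw [add_sub_cancel] at e2
    have e3 : 0 < t ^ n := by positivity
    nlinarith
  have h11 := outerPot_nonneg n s 1 τ
  have h12 : (1 - t ^ n * t ^ (-s)) * outerPot n s 1 τ ≤
      n * (sphereArea n / s) * (1 - t) ^ (1 - s) := by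
    calc _ ≤ n * (1 - t) * outerPot n s 1 τ := mul_le_mul_of_nonneg_right h10 h11
      _ ≤ n * (1 - t) * (sphereArea n / s * (1 - t) ^ (-s)) :=
        mul_le_mul_of_nonneg_left h9 (by positivity)
      _ = _ := by
        rw [show (1 : ℝ) - s = 1 + -s by ring, Real.rpow_add hu, Real.rpow_one]
        ring
  have h13 : ((n : ℝ) - s) * interaction n s t 1 ≤ ((n : ℝ) - s) * interaction n s 1 1 :=
    mul_le_mul_of_nonneg_left h8 (by linarith [hs.2])
  rw [inter_comm B A] at h3
  rw [h7] at h6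
  nlinarith

lemma ballCurv_le {n : ℕ} [NeZero n] {s : ℝ} (hs : s ∈ Ioo (0 : ℝ) 1) :
    IntegrableOn (fun h => ‖h‖ ^ (-((n : ℝ) + s))) (doubleOut (baseVec n)) ∧
      ballCurv n s ≤ ((n : ℝ) - s) * interaction n s 1 1 := by
  set e := baseVec n with he
  set f : EuclideanSpace ℝ (Fin n) → ℝ := fun h => ‖h‖ ^ (-((n : ℝ) + s)) with hf
  set t : ℕ → ℝ := fun m => 1 - 1 / ((m : ℝ) + 2) with ht
  have htmem : ∀ m, t m ∈ Ico (1 / 2 : ℝ) 1 := by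
    intro m
    have h1 : (0 : ℝ) < (m : ℝ) + 2 := by positivity
    have h2 : 1 / ((m : ℝ) + 2) ≤ 1 / 2 :=
      one_div_le_one_div_of_le two_pos (by linarith [(Nat.cast_nonneg m : (0 : ℝ) ≤ m)])
    have h3 : 0 < 1 / ((m : ℝ) + 2) := by positivity
    simp only [ht]
    constructor <;> linarith
  have hlim0 : Tendsto (fun m => 1 - t m) atTop (𝓝 0) := by
    have h := (tendsto_one_div_add_atTop_nhds_zero_nat (𝕜 := ℝ)).comp (tendsto_add_atTop_nat 1)
    refine h.congr fun m => ?_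
    simp only [ht, Function.comp, sub_sub_cancel]
    push_cast
    ring
  set K := (n : ℝ) * (sphereArea n / s) + 6 ^ (n + 1) with hK
  have hlim : Tendsto (fun m => ((n : ℝ) - s) * interaction n s 1 1 + K * (1 - t m) ^ (1 - s))
      atTop (𝓝 (((n : ℝ) - s) * interaction n s 1 1)) := by
    have h1 : 0 < 1 - s := by linarith [hs.2]
    have h := (hlim0.rpow_const (p := 1 - s) (Or.inr h1.le)).const_mul K
    rw [Real.zero_rpow h1.ne', mul_zero] at h
    simpa using h.const_add (((n : ℝ) - s) * interaction n s 1 1)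
  set φ : ℕ → Set (EuclideanSpace ℝ (Fin n)) := fun m => {h | 1 / t m ≤ ‖e + h‖} with hφ
  have hφm : ∀ m, MeasurableSet (φ m) := fun m => measurableSet_le (by fun_prop) (by fun_prop)
  have hcover : AECover (volume.restrict (doubleOut e)) atTop φ := by
    refine ⟨?_, hφm⟩
    have hnull : ∀ᵐ h : EuclideanSpace ℝ (Fin n), h ∉ sphere (-e) 1 :=
      measure_eq_zero_iff_ae_notMem.1 (Measure.addHaar_sphere volume _ _)
    filter_upwards [ae_restrict_mem (measurableSet_doubleOut e), ae_restrict_of_ae hnull]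
      with h h1 h2
    have h3 : 1 < ‖e + h‖ := by
      refine lt_of_le_of_ne ?_ fun h4 => h2 ?_
      · have := h1.1
        rwa [norm_baseVec] at this
      · rw [mem_sphere_iff_norm, sub_neg_eq_add, add_comm, ← h4]
    have h4 : Tendsto (fun m => 1 / t m) atTop (𝓝 1) := by
      have h5 : Tendsto t atTop (𝓝 1) := by
        have := hlim0.const_sub 1
        simpa using this
      simpa using h5.inv₀ one_ne_zero
    exact h4.eventually_le_const h3
  have hfi : ∀ m, ∫ h in φ m, f h ∂(volume.restrict (doubleOut e)) =
      ∫ h in doubleOut e ∩ φ m, f h := by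
    intro m
    rw [Measure.restrict_restrict (hφm m), inter_comm]
  have hle : ∀ m, ∫ h in φ m, f h ∂(volume.restrict (doubleOut e)) ≤
      ((n : ℝ) - s) * interaction n s 1 1 + K * (1 - t m) ^ (1 - s) := fun m => by
    rw [hfi]; exact (setIntegral_doubleOut_le hs (htmem m)).2
  have hI : IntegrableOn f (doubleOut e) := by
    refine hcover.integrable_of_integral_bounded_of_nonneg_ae
      (((n : ℝ) - s) * interaction n s 1 1 + 1) (fun m => ?_)
      (Eventually.of_forall fun _ => by simp only [hf]; positivity) ?_
    · exact (setIntegral_doubleOut_le hs (htmem m)).1.mono_measure Measure.restrict_le_self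
    · filter_upwards [hlim.eventually_le_const (lt_add_one _)] with m hm
      exact (hle m).trans hm
  refine ⟨hI, ?_⟩
  rw [ballCurv, fracPot_zero]
  exact le_of_tendsto_of_tendsto' (hcover.integral_tendsto_of_countably_generated hI) hlim hle

lemma ballCurv_pos {n : ℕ} [NeZero n] {s : ℝ} (hs : s ∈ Ioo (0 : ℝ) 1) : 0 < ballCurv n s := by
  have h1 := setIntegral_kernel (n := n) hs.1 (two_pos (α := ℝ))
  have h2 : 0 < sphereArea n / s * (2 : ℝ) ^ (-s) :=
    mul_pos (div_pos (sphereArea_pos n) hs.1) (by positivity)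
  rw [← h1] at h2
  rw [ballCurv, fracPot_zero]
  refine h2.trans_le (setIntegral_mono_set (ballCurv_le hs).1
    (Eventually.of_forall fun _ => by positivity) (Eventually.of_forall fun h hh => ?_))
  have h3 : 2 ≤ ‖h‖ := hh
  have h4 := norm_sub_le_norm_add h (baseVec n)
  have h5 := norm_sub_norm_le h (baseVec n)
  rw [add_comm] at h4
  rw [norm_sub_rev] at h5
  rw [norm_baseVec] at h4 h5
  refine ⟨?_, ?_⟩ <;> rw [norm_baseVec] <;> linarith

lemma fracPot_doubleOut {n : ℕ} [NeZero n] (s : ℝ) {x : EuclideanSpace ℝ (Fin n)} (hx : 0 < ‖x‖) :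
    fracPot s (doubleOut x) 0 = ‖x‖ ^ (-s) * ballCurv n s := by
  obtain ⟨L, hL⟩ := exists_isometry_map_eq (norm_smul_baseVec (n := n) hx.le)
  have h1 : L ⁻¹' doubleOut x = doubleOut (‖x‖ • baseVec n) := by
    ext h
    simp only [doubleOut, mem_preimage, mem_ofPred_eq]
    rw [← L.norm_map (_ + h), ← L.norm_map (_ - h), map_add, map_sub, hL,
      norm_smul_baseVec hx.le]
  have h2 : {h | ‖x‖ • h ∈ doubleOut (‖x‖ • baseVec n)} = doubleOut (baseVec n) := by
    ext h
    simp only [doubleOut, mem_ofPred_eq]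
    rw [← smul_add, ← smul_sub, norm_smul, norm_smul, norm_smul, norm_norm,
      mul_le_mul_iff_right₀ hx, mul_le_mul_iff_right₀ hx]
  have h3 := fracPot_isometry s L (doubleOut x) 0
  rw [map_zero, h1] at h3
  have h4 := fracPot_smul s hx (doubleOut (‖x‖ • baseVec n)) 0
  rw [h2, smul_zero, h3] at h4
  rw [ballCurv, h4, ← mul_assoc, ← Real.rpow_add hx]
  simp

lemma integrableOn_bounded_mul_kernel {n : ℕ} [NeZero n] {s ε : ℝ} (hs : 0 < s) (hε : 0 < ε)
    (x : EuclideanSpace ℝ (Fin n)) {w : EuclideanSpace ℝ (Fin n) → ℝ} (hw : Measurable w)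
    (hw1 : ∀ y, |w y| ≤ 1) :
    IntegrableOn (fun y => w y * ‖x - y‖ ^ (-((n : ℝ) + s))) {y | ε < ‖x - y‖} := by
  have hsub : {y | ε < ‖x - y‖} ⊆ {y | ε ≤ ‖x - y‖} := fun y (hy : ε < ‖x - y‖) => hy.le
  refine Integrable.mono' ((integrableOn_kernel_sub hs hε x).mono_set hsub)
    ((hw.mul (measurable_kernel s x)).aestronglyMeasurable)
    (Eventually.of_forall fun y => ?_)
  rw [norm_mul, Real.norm_eq_abs, Real.norm_of_nonneg (by positivity)]
  exact mul_le_of_le_one_left (by positivity) (hw1 y)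

lemma tendsto_ball_curvature {n : ℕ} [NeZero n] {s : ℝ} (hs : s ∈ Ioo (0 : ℝ) 1)
    {x : EuclideanSpace ℝ (Fin n)} (hx : 0 < ‖x‖) :
    Tendsto (fun ε : ℝ => ∫ y in {y | ε < ‖x - y‖},
      (1 - 2 * (ball 0 ‖x‖).indicator (fun _ => (1 : ℝ)) y) * ‖x - y‖ ^ (-((n : ℝ) + s)))
      (𝓝[>] 0) (𝓝 (‖x‖ ^ (-s) * ballCurv n s)) := by
  set w : EuclideanSpace ℝ (Fin n) → ℝ :=
    fun y => 1 - 2 * (ball 0 ‖x‖).indicator (fun _ => (1 : ℝ)) y with hw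
  have hwm : Measurable w :=
    measurable_const.sub (measurable_const.mul (measurable_const.indicator measurableSet_ball))
  have hw1 : ∀ y, |w y| ≤ 1 := fun y => by
    by_cases h : y ∈ ball (0 : EuclideanSpace ℝ (Fin n)) ‖x‖ <;> simp only [hw, h, indicator_of_mem,
      indicator_of_notMem, not_false_eq_true] <;> norm_num
  have hval := fracPot_doubleOut (n := n) s hx
  have hI : IntegrableOn (fun h => ‖h‖ ^ (-((n : ℝ) + s))) (doubleOut x) := by
    refine Integrable.of_integral_ne_zero ?_
    rw [← fracPot_zero, hval]
    exact (mul_pos (Real.rpow_pos_of_pos hx _) (ballCurv_pos hs)).ne'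
  have hcover : AECover (volume.restrict (doubleOut x)) (𝓝[>] (0 : ℝ))
      fun ε => {h : EuclideanSpace ℝ (Fin n) | ε < ‖h‖} := by
    refine ⟨?_, fun ε => measurableSet_lt measurable_const measurable_norm⟩
    have hnull : ∀ᵐ h : EuclideanSpace ℝ (Fin n), h ∉ ({0} : Set (EuclideanSpace ℝ (Fin n))) :=
      measure_eq_zero_iff_ae_notMem.1 (measure_singleton _)
    filter_upwards [ae_restrict_of_ae hnull] with h hh
    exact (eventually_lt_nhds (norm_pos_iff.2 hh)).filter_mono nhdsWithin_le_nhds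
  have hT := hcover.integral_tendsto_of_countably_generated hI
  rw [← fracPot_zero, hval] at hT
  refine hT.congr' ?_
  filter_upwards [self_mem_nhdsWithin] with ε hε
  have hSm : MeasurableSet {h : EuclideanSpace ℝ (Fin n) | ε < ‖h‖} :=
    measurableSet_lt measurable_const measurable_norm
  set F : EuclideanSpace ℝ (Fin n) → ℝ := fun y => w y * ‖x - y‖ ^ (-((n : ℝ) + s)) with hF
  have hFi : IntegrableOn F {y | ε < ‖x - y‖} :=
    integrableOn_bounded_mul_kernel hs.1 hε x hwm hw1
  have e1 := setIntegral_add_left F {y | ε < ‖x - y‖} x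
  have e2 := setIntegral_sub_left F {y | ε < ‖x - y‖} x
  have i1 := ((measurePreserving_add_left volume x).integrableOn_comp_preimage
    (measurableEmbedding_addLeft x)).2 hFi
  have i2 := integrableOn_sub_left hFi x
  have s1 : (fun y => x + y) ⁻¹' {y | ε < ‖x - y‖} = {h | ε < ‖h‖} := by
    ext y; simp
  have s1' : {y | x + y ∈ {y | ε < ‖x - y‖}} = {h | ε < ‖h‖} := s1
  have s2 : {y | x - y ∈ {y | ε < ‖x - y‖}} = {h | ε < ‖h‖} := by
    ext y; simp
  rw [s1'] at e1
  rw [s1] at i1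
  replace i1 : IntegrableOn (fun h => F (x + h)) {h | ε < ‖h‖} := i1
  rw [s2] at e2 i2
  have e3 : ∫ y in {y | ε < ‖x - y‖}, F y =
      ∫ h in {h | ε < ‖h‖}, (1 / 2) * (F (x + h) + F (x - h)) := by
    rw [integral_const_mul, integral_add i1 i2, e1, e2]
    ring
  rw [e3, Measure.restrict_restrict hSm, ← setIntegral_indicator (measurableSet_doubleOut x)]
  refine setIntegral_congr_fun hSm fun h _ => ?_
  have hnot : ¬ (‖x + h‖ < ‖x‖ ∧ ‖x - h‖ < ‖x‖) := by
    rintro ⟨h1, h2⟩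
    have h3 := norm_add_le (x + h) (x - h)
    rw [add_add_sub_cancel, ← two_smul ℝ x, norm_smul, Real.norm_two] at h3
    linarith
  simp only [hF, hw, sub_add_cancel_left, norm_neg, sub_sub_cancel, indicator, doubleOut,
    mem_ball_zero_iff, mem_ofPred_eq]
  by_cases h1 : ‖x + h‖ < ‖x‖ <;> by_cases h2 : ‖x - h‖ < ‖x‖
  · exact absurd ⟨h1, h2⟩ hnot
  · simp [h1, h2, not_le.2 h1, not_lt.1 h2]; ring
  · simp [h1, h2, not_le.2 h2, not_lt.1 h1]; ring
  · simp [h1, h2, not_lt.1 h1, not_lt.1 h2]; ring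

/-- The interaction energy of two concentric balls, as a symmetric function of their radii. -/
noncomputable def symInteraction (n : ℕ) [NeZero n] (s a b : ℝ) : ℝ :=
  interaction n s (min a b) (max a b)

/-- The potential of a ball of radius `b` or of its complement (with opposite sign), whichever
does not contain the points at distance `a`. -/
noncomputable def crossPot (n : ℕ) [NeZero n] (s a b : ℝ) : ℝ :=
  if a < b then outerPot n s a b else -innerPot n s a b

lemma crossPot_smul {n : ℕ} [NeZero n] (s : ℝ) {t : ℝ} (ht : 0 < t) (a b : ℝ) :
    crossPot n s (t * a) (t * b) = t ^ (-s) * crossPot n s a b := by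
  unfold crossPot
  simp only [mul_lt_mul_iff_right₀ ht, outerPot_smul s ht, innerPot_smul s ht]
  split_ifs <;> ring

lemma symInteraction_comm {n : ℕ} [NeZero n] (s a b : ℝ) :
    symInteraction n s a b = symInteraction n s b a := by
  rw [symInteraction, symInteraction, min_comm, max_comm]

lemma interaction_zero_left {n : ℕ} [NeZero n] (s b : ℝ) : interaction n s 0 b = 0 := by
  simp [interaction]

lemma symInteraction_zero_left {n : ℕ} [NeZero n] (s : ℝ) {b : ℝ} (hb : 0 ≤ b) :
    symInteraction n s 0 b = 0 := by
  rw [symInteraction, min_eq_left hb, interaction_zero_left]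

lemma symInteraction_self {n : ℕ} [NeZero n] {s v : ℝ} (hs : s ∈ Ioo (0 : ℝ) 1) (hv : 0 ≤ v) :
    symInteraction n s v v = interaction n s 1 1 * v ^ ((n : ℝ) - s) := by
  have hn : (1 : ℝ) ≤ n := by exact_mod_cast NeZero.pos n
  rcases hv.eq_or_lt with rfl | hv
  · rw [symInteraction_zero_left s le_rfl, Real.zero_rpow (by linarith [hs.2]), mul_zero]
  · rw [symInteraction, min_self, max_self, interaction_eq s v hv, div_self hv.ne', mul_comm]

lemma symInteraction_nonneg {n : ℕ} [NeZero n] (s : ℝ) {a b : ℝ} (ha : 0 ≤ a) (hb : 0 ≤ b) :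
    0 ≤ symInteraction n s a b :=
  interaction_nonneg s (le_min ha hb) _

lemma symInteraction_le {n : ℕ} [NeZero n] {s a b M : ℝ} (hs : s ∈ Ioo (0 : ℝ) 1) (ha : 0 ≤ a)
    (haM : a ≤ M) (hb : 0 ≤ b) (hbM : b ≤ M) :
    symInteraction n s a b ≤ interaction n s 1 1 * M ^ ((n : ℝ) - s) := by
  have hn : (1 : ℝ) ≤ n := by exact_mod_cast NeZero.pos n
  have hG : 0 ≤ interaction n s 1 1 := interaction_nonneg s zero_le_one _
  wlog hab : a ≤ b generalizing a b
  · rw [symInteraction_comm]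
    exact this hb hbM ha haM (le_of_not_ge hab)
  rw [symInteraction, min_eq_left hab, max_eq_right hab]
  rcases hb.eq_or_lt with rfl | hb
  · rw [le_antisymm hab ha, interaction_zero_left]
    exact mul_nonneg hG (Real.rpow_nonneg (ha.trans haM) _)
  · rw [interaction_eq s a hb, mul_comm]
    refine mul_le_mul ?_ (Real.rpow_le_rpow hb.le hbM (by linarith [hs.2]))
      (Real.rpow_nonneg hb.le _) hG
    exact interaction_mono hs (div_nonneg ha hb.le) ((div_le_one hb).2 hab) le_rfl one_pos

lemma continuousOn_symInteraction {n : ℕ} [NeZero n] {s : ℝ} (hs : s ∈ Ioo (0 : ℝ) 1) :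
    ContinuousOn (fun p : ℝ × ℝ => symInteraction n s p.1 p.2) (Ici 0 ×ˢ Ici 0) := by
  have hn : (1 : ℝ) ≤ n := by exact_mod_cast NeZero.pos n
  have hα : 0 < (n : ℝ) - s := by linarith [hs.2]
  rintro ⟨a, b⟩ ⟨ha, hb⟩
  simp only [mem_Ici] at ha hb
  rcases (le_max_of_le_left ha : 0 ≤ max a b).eq_or_lt with h0 | h0
  · have ha0 : a = 0 := le_antisymm (h0 ▸ le_max_left a b) ha
    have hb0 : b = 0 := le_antisymm (h0 ▸ le_max_right a b) hb
    subst ha0 hb0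
    rw [ContinuousWithinAt, symInteraction_zero_left s le_rfl]
    have hc : Continuous fun p : ℝ × ℝ =>
        interaction n s 1 1 * (max p.1 p.2) ^ ((n : ℝ) - s) :=
      continuous_const.mul ((continuous_fst.max continuous_snd).rpow_const fun _ => Or.inr hα.le)
    have hlim := hc.tendsto ((0 : ℝ), (0 : ℝ))
    simp only [max_self, Real.zero_rpow hα.ne', mul_zero] at hlim
    refine squeeze_zero' ?_ ?_ (hlim.mono_left nhdsWithin_le_nhds)
    · filter_upwards [self_mem_nhdsWithin] with p hp
      exact symInteraction_nonneg s hp.1 hp.2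
    · filter_upwards [self_mem_nhdsWithin] with p hp
      exact symInteraction_le hs hp.1 (le_max_left _ _) hp.2 (le_max_right _ _)
  · have hg := (continuousOn_interaction (n := n) hs one_pos)
    have hmap : MapsTo (fun p : ℝ × ℝ => min p.1 p.2 / max p.1 p.2)
        (Ici 0 ×ˢ Ici 0) (Icc 0 1) := by
      rintro ⟨a, b⟩ ⟨ha, hb⟩
      simp only [mem_Ici] at ha hb
      have := (le_max_of_le_left ha : 0 ≤ max a b)
      exact ⟨div_nonneg (le_min ha hb) this, div_le_one_of_le₀ min_le_max this⟩
    have hq : ContinuousAt (fun p : ℝ × ℝ => min p.1 p.2 / max p.1 p.2) (a, b) :=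
      (continuous_fst.min continuous_snd).continuousAt.div
        (continuous_fst.max continuous_snd).continuousAt h0.ne'
    have hcomp := ContinuousWithinAt.comp (x := ((a, b) : ℝ × ℝ))
      (hg _ (hmap (show (a, b) ∈ Ici (0 : ℝ) ×ˢ Ici (0 : ℝ) from ⟨ha, hb⟩))) hq.continuousWithinAt hmap
    have hpow : ContinuousAt (fun p : ℝ × ℝ => (max p.1 p.2) ^ ((n : ℝ) - s)) (a, b) :=
      (continuous_fst.max continuous_snd).continuousAt.rpow_const (Or.inr hα.le)
    refine (hpow.continuousWithinAt.mul hcomp).congr_of_eventuallyEq ?_ ?_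
    · filter_upwards [nhdsWithin_le_nhds ((continuous_fst.max continuous_snd).continuousAt.eventually
        (eventually_gt_nhds h0))] with p hp
      exact interaction_eq s _ hp
    · exact interaction_eq s _ h0

lemma tendsto_symInteraction_div {n : ℕ} [NeZero n] {s b : ℝ} (hs : s ∈ Ioo (0 : ℝ) 1)
    (hb : 0 ≤ b) :
    Tendsto (fun δ => symInteraction n s δ b / δ ^ ((n : ℝ) - s)) (𝓝[>] 0) (𝓝 0) := by
  rcases hb.eq_or_lt with rfl | hb
  · refine tendsto_const_nhds.congr' ?_
    filter_upwards [self_mem_nhdsWithin] with δ hδ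
    rw [symInteraction_comm, symInteraction_zero_left s (le_of_lt hδ), zero_div]
  set K := sphereArea n / s * (b / 2) ^ (-s) with hK
  have hK0 : 0 ≤ K := mul_nonneg (div_nonneg (sphereArea_pos n).le hs.1.le) (by positivity)
  have hlim : Tendsto (fun δ : ℝ => K * δ ^ s) (𝓝[>] 0) (𝓝 0) := by
    have h := ((Real.continuousAt_rpow_const 0 s (Or.inr hs.1.le)).tendsto.const_mul K).mono_left
      (nhdsWithin_le_nhds (s := Ioi 0))
    simpa [Real.zero_rpow hs.1.ne'] using h
  refine squeeze_zero' ?_ ?_ hlim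
  · filter_upwards [self_mem_nhdsWithin] with δ hδ
    exact div_nonneg (symInteraction_nonneg s (le_of_lt hδ) hb.le) (Real.rpow_nonneg (le_of_lt hδ) _)
  · filter_upwards [self_mem_nhdsWithin,
      nhdsWithin_le_nhds (eventually_lt_nhds (half_pos hb))] with δ hδ hδb
    have hδ : 0 < δ := hδ
    rw [symInteraction, min_eq_left (by linarith), max_eq_right (by linarith),
      div_le_iff₀ (Real.rpow_pos_of_pos hδ _), mul_assoc, ← Real.rpow_add hδ, add_sub_cancel,
      Real.rpow_natCast]
    have h1 : ‖∫ ρ in (0 : ℝ)..δ, ρ ^ (n - 1) * outerPot n s ρ b‖ ≤ δ ^ (n - 1) * K * |δ - 0| := by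
      refine intervalIntegral.norm_integral_le_of_norm_le_const fun ρ hρ => ?_
      rw [uIoc_of_le hδ.le] at hρ
      rw [Real.norm_of_nonneg (mul_nonneg (pow_nonneg hρ.1.le _) (outerPot_nonneg _ _ _ _))]
      refine mul_le_mul (pow_le_pow_left₀ hρ.1.le hρ.2 _) ?_ (outerPot_nonneg _ _ _ _)
        (by positivity)
      refine (outerPot_le hs.1 hρ.1.le (by linarith [hρ.2])).trans ?_
      refine mul_le_mul_of_nonneg_left ?_ (div_nonneg (sphereArea_pos n).le hs.1.le)
      exact Real.rpow_le_rpow_of_nonpos (half_pos hb) (by linarith [hρ.2]) (by linarith [hs.1])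
    refine (le_abs_self _).trans (h1.trans_eq ?_)
    rw [sub_zero, abs_of_pos hδ]
    have h7 : δ ^ n = δ ^ (n - 1) * δ := by
      rw [← pow_succ, Nat.sub_add_cancel (NeZero.pos n)]
    rw [h7]
    ring

lemma hasDerivAt_symInteraction {n : ℕ} [NeZero n] {s a b : ℝ} (hs : s ∈ Ioo (0 : ℝ) 1)
    (ha : 0 < a) (hb : 0 < b) (hab : a ≠ b) :
    HasDerivAt (fun t => symInteraction n s t b) (a ^ (n - 1) * crossPot n s a b) a := by
  rcases lt_or_gt_of_ne hab with h | h
  · rw [crossPot, if_pos h]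
    refine (hasDerivAt_interaction_left hs ha h).congr_of_eventuallyEq ?_
    filter_upwards [eventually_lt_nhds h] with t ht
    rw [symInteraction, min_eq_left ht.le, max_eq_right ht.le]
  · rw [crossPot, if_neg h.not_gt, mul_neg]
    refine (hasDerivAt_interaction_right hs hb h).congr_of_eventuallyEq ?_
    filter_upwards [eventually_gt_nhds h] with t ht
    rw [symInteraction, min_eq_right ht.le, max_eq_left ht.le]

/-- Radii of balanced concentric shells: the curvature of the boundary sphere of radius `r i`
is a fixed multiple of `r i`, up to the sign `(-1) ^ i`. -/
lemma exists_balanced_radii (n : ℕ) [NeZero n] {s : ℝ} (hs : s ∈ Ioo (0 : ℝ) 1) {m : ℕ}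
    (hm : 1 ≤ m) :
    ∃ r : ℕ → ℝ, 0 < r 1 ∧ (∀ i, 1 ≤ i → i < m → r i < r (i + 1)) ∧
      ∀ i ∈ Finset.Icc 1 m, r i ^ (-s) * ballCurv n s + 2 * ∑ j ∈ (Finset.Icc 1 m).erase i,
        (-1 : ℝ) ^ i * ((-1 : ℝ) ^ j * crossPot n s (r i) (r j)) = (n + 1) * r i := by
  have hn : (1 : ℝ) ≤ n := by exact_mod_cast NeZero.pos n
  have hα : 0 < (n : ℝ) - s := by linarith [hs.2]
  have hc := ballCurv_pos (n := n) hs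
  have hle := (ballCurv_le (n := n) hs).2
  set G := interaction n s 1 1 with hG
  obtain ⟨r, h1, hstep, hr⟩ := exists_critical_radii m hm hα (β := n + 1)
    (by push_cast; linarith [hs.1]) (S := symInteraction n s)
    (dS := fun a b => a ^ (n - 1) * crossPot n s a b) (G := G)
    (κ := G - ballCurv n s / ((n : ℝ) - s))
    (symInteraction_comm s) (continuousOn_symInteraction hs)
    (by rw [sub_nonneg, div_le_iff₀ hα]; linarith)
    (by linarith [div_pos hc hα])
    (fun v hv => symInteraction_self hs hv)
    (fun a b M ha haM hb hbM => by
      rw [abs_of_nonneg (symInteraction_nonneg s ha hb)]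
      exact symInteraction_le hs ha haM hb hbM)
    (fun b hb => symInteraction_zero_left s hb)
    (fun b hb => tendsto_symInteraction_div hs hb)
    (fun a b ha hb hab => hasDerivAt_symInteraction hs ha hb hab)
  refine ⟨r, h1, hstep, fun i hi => ?_⟩
  have hri : 0 < r i := by
    rw [Finset.mem_Icc] at hi
    rcases hi.1.eq_or_lt with rfl | h
    · exact h1
    · exact h1.trans (strictMono_of_step hstep le_rfl h hi.2)
  have e1 : r i ^ ((n : ℝ) - s - 1) = r i ^ (n - 1) * r i ^ (-s) := by
    rw [← Real.rpow_natCast, ← Real.rpow_add hri, Nat.cast_sub (NeZero.pos n)]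
    congr 1
    push_cast
    ring
  have e2 : r i ^ (n + 1 - 1) = r i ^ (n - 1) * r i := by
    rw [← pow_succ, Nat.sub_add_cancel (NeZero.pos n), Nat.add_sub_cancel]
  have h := hr i hi
  have e3 : ∑ j ∈ (Finset.Icc 1 m).erase i,
      (-1 : ℝ) ^ i * ((-1 : ℝ) ^ j * (r i ^ (n - 1) * crossPot n s (r i) (r j))) =
      r i ^ (n - 1) * ∑ j ∈ (Finset.Icc 1 m).erase i,
        (-1 : ℝ) ^ i * ((-1 : ℝ) ^ j * crossPot n s (r i) (r j)) := by
    rw [Finset.mul_sum]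
    exact Finset.sum_congr rfl fun j _ => by ring
  rw [e1, e2, e3, sub_sub_cancel] at h
  have hp : 0 < r i ^ (n - 1) := by positivity
  refine mul_left_cancel₀ hp.ne' ?_
  have e4 : ballCurv n s / ((n : ℝ) - s) * (((n : ℝ) - s) * (r i ^ (n - 1) * r i ^ (-s))) =
      r i ^ (n - 1) * (r i ^ (-s) * ballCurv n s) := by
    field_simp
  rw [e4] at h
  push_cast at h
  linear_combination h

/-- The union of the concentric shells `B_{r (2k)} \ B_{r (2k-1)}`, `1 ≤ k ≤ N`. -/
def shells (n N : ℕ) (r : ℕ → ℝ) : Set (EuclideanSpace ℝ (Fin n)) :=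
  ⋃ k ∈ Finset.Icc 1 N, (ball (0 : EuclideanSpace ℝ (Fin n)) (r (2 * k)) \ ball 0 (r (2 * k - 1)))

lemma shells_succ (n N : ℕ) (r : ℕ → ℝ) : shells n (N + 1) r =
    shells n N r ∪ (ball 0 (r (2 * N + 2)) \ ball 0 (r (2 * N + 1))) := by
  unfold shells
  rw [← Finset.insert_Icc_right_eq_Icc_add_one (by omega), Finset.set_biUnion_insert, union_comm]
  rfl

lemma shells_subset {n N : ℕ} {r : ℕ → ℝ} (hr : ∀ i, 1 ≤ i → i < 2 * N → r i < r (i + 1)) :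
    shells n N r ⊆ ball 0 (r (2 * N)) := by
  refine iUnion₂_subset fun k hk => sdiff_subset.trans (ball_subset_ball ?_)
  rw [Finset.mem_Icc] at hk
  rcases hk.2.eq_or_lt with rfl | h
  · exact le_rfl
  · exact (strictMono_of_step hr (by omega) (by omega) le_rfl : r (2 * k) < r (2 * N)).le

lemma indicator_shells {n N : ℕ} {r : ℕ → ℝ} (hr : ∀ i, 1 ≤ i → i < 2 * N → r i < r (i + 1))
    (y : EuclideanSpace ℝ (Fin n)) :
    (shells n N r).indicator (fun _ => (1 : ℝ)) y =
      ∑ j ∈ Finset.Icc 1 (2 * N), (-1 : ℝ) ^ j * (ball 0 (r j)).indicator (fun _ => (1 : ℝ)) y := by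
  induction N with
  | zero => simp [shells]
  | succ N ih =>
    have hr' : ∀ i, 1 ≤ i → i < 2 * N → r i < r (i + 1) := fun i h1 h2 => hr i h1 (by omega)
    have h1 : ball (0 : EuclideanSpace ℝ (Fin n)) (r (2 * N + 1)) ⊆ ball 0 (r (2 * N + 2)) :=
      ball_subset_ball (hr (2 * N + 1) (by omega) (by omega)).le
    have h2 : shells n N r ⊆ ball 0 (r (2 * N + 1)) := by
      rcases N.eq_zero_or_pos with rfl | hN
      · simp [shells]
      · exact (shells_subset hr').trans (ball_subset_ball (hr (2 * N) (by omega) (by omega)).le)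
    have hd : Disjoint (shells n N r) (ball 0 (r (2 * N + 2)) \ ball 0 (r (2 * N + 1))) :=
      disjoint_left.2 fun z hz hz' => hz'.2 (h2 hz)
    rw [show 2 * (N + 1) = 2 * N + 1 + 1 by ring, Finset.sum_Icc_succ_top (by omega),
      Finset.sum_Icc_succ_top (by omega), ← ih hr', shells_succ, indicator_union_of_disjoint hd,
      indicator_sdiff h1]
    have heven : (-1 : ℝ) ^ (2 * N) = 1 := by rw [pow_mul]; simp
    simp only [Pi.sub_apply, pow_succ, heven]
    ring

lemma two_mul_sum_Ioc_neg_one_pow {i m : ℕ} (h : i ≤ m) :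
    2 * ∑ j ∈ Finset.Ioc i m, (-1 : ℝ) ^ j = (-1) ^ m - (-1) ^ i := by
  induction m, h using Nat.le_induction with
  | base => simp
  | succ m hm ih =>
    rw [Finset.sum_Ioc_succ_top (by omega), mul_add, ih, pow_succ]
    ring

/-- The signed indicator function whose potential is `crossPot`. -/
noncomputable def crossInd {n : ℕ} (a b : ℝ) (y : EuclideanSpace ℝ (Fin n)) : ℝ :=
  (if a < b then 1 else 0) - (ball 0 b).indicator (fun _ => (1 : ℝ)) y

lemma signed_indicator_shells {n N : ℕ} {r : ℕ → ℝ}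
    (hr : ∀ i, 1 ≤ i → i < 2 * N → r i < r (i + 1)) {i : ℕ} (hi : i ∈ Finset.Icc 1 (2 * N))
    (y : EuclideanSpace ℝ (Fin n)) :
    (shells n N r)ᶜ.indicator (fun _ => (1 : ℝ)) y - (shells n N r).indicator (fun _ => (1 : ℝ)) y =
      (-1) ^ i * (1 - 2 * (ball 0 (r i)).indicator (fun _ => (1 : ℝ)) y) +
        ∑ j ∈ (Finset.Icc 1 (2 * N)).erase i, 2 * (-1) ^ j * crossInd (r i) (r j) y := by
  have hi' := Finset.mem_Icc.1 hi
  have h1 : (shells n N r)ᶜ.indicator (fun _ => (1 : ℝ)) y =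
      1 - (shells n N r).indicator (fun _ => (1 : ℝ)) y := by
    by_cases h : y ∈ shells n N r <;> simp [h]
  have h2 : ∑ j ∈ (Finset.Icc 1 (2 * N)).erase i, (-1 : ℝ) ^ j * (if r i < r j then 1 else 0) =
      ∑ j ∈ Finset.Ioc i (2 * N), (-1 : ℝ) ^ j := by
    simp only [mul_ite, mul_one, mul_zero]
    rw [← Finset.sum_filter]
    refine Finset.sum_congr ?_ fun _ _ => rfl
    ext j
    simp only [Finset.mem_filter, Finset.mem_erase, Finset.mem_Icc, Finset.mem_Ioc]
    constructor
    · rintro ⟨⟨hne, h3, h4⟩, h5⟩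
      refine ⟨?_, h4⟩
      by_contra h6
      exact (strictMono_of_step hr h3 (by omega) hi'.2 : r j < r i).not_gt h5
    · rintro ⟨h3, h4⟩
      exact ⟨⟨by omega, by omega, h4⟩, strictMono_of_step hr hi'.1 h3 h4⟩
  have h3 := two_mul_sum_Ioc_neg_one_pow hi'.2
  rw [pow_mul, neg_one_sq, one_pow] at h3
  rw [h1, indicator_shells hr, ← Finset.add_sum_erase _ _ hi]
  have h4 : ∑ j ∈ (Finset.Icc 1 (2 * N)).erase i, 2 * (-1 : ℝ) ^ j * crossInd (r i) (r j) y =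
      2 * ∑ j ∈ (Finset.Icc 1 (2 * N)).erase i, (-1 : ℝ) ^ j * (if r i < r j then 1 else 0) -
      2 * ∑ j ∈ (Finset.Icc 1 (2 * N)).erase i,
        (-1 : ℝ) ^ j * (ball 0 (r j)).indicator (fun _ => (1 : ℝ)) y := by
    rw [Finset.mul_sum, Finset.mul_sum, ← Finset.sum_sub_distrib]
    exact Finset.sum_congr rfl fun j _ => by rw [crossInd]; ring
  rw [h4, h2]
  linarith

lemma measurable_crossInd {n : ℕ} (a b : ℝ) :
    Measurable (crossInd a b : EuclideanSpace ℝ (Fin n) → ℝ) :=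
  measurable_const.sub (measurable_const.indicator measurableSet_ball)

lemma crossInd_of_lt {n : ℕ} {a b : ℝ} (hab : a < b) (y : EuclideanSpace ℝ (Fin n)) :
    crossInd a b y = (ball 0 b)ᶜ.indicator (fun _ => (1 : ℝ)) y := by
  by_cases h : y ∈ ball (0 : EuclideanSpace ℝ (Fin n)) b <;> simp [crossInd, hab, h]

lemma crossInd_of_not_lt {n : ℕ} {a b : ℝ} (hab : ¬ a < b) (y : EuclideanSpace ℝ (Fin n)) :
    crossInd a b y = -(ball 0 b).indicator (fun _ => (1 : ℝ)) y := by
  simp [crossInd, hab]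

lemma abs_crossInd_le {n : ℕ} (a b : ℝ) (y : EuclideanSpace ℝ (Fin n)) : |crossInd a b y| ≤ 1 := by
  by_cases hab : a < b <;> by_cases h : y ∈ ball (0 : EuclideanSpace ℝ (Fin n)) b <;>
    simp only [crossInd, hab, h, if_true, if_false, indicator_of_mem, indicator_of_notMem,
      not_false_eq_true] <;> norm_num

lemma setIntegral_indicator_kernel {n : ℕ} (s : ℝ) {S T : Set (EuclideanSpace ℝ (Fin n))}
    (hS : MeasurableSet S) (hST : S ⊆ T) (x : EuclideanSpace ℝ (Fin n)) :
    ∫ y in T, S.indicator (fun _ => (1 : ℝ)) y * ‖x - y‖ ^ (-((n : ℝ) + s)) = fracPot s S x := by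
  have h : (fun y => S.indicator (fun _ => (1 : ℝ)) y * ‖x - y‖ ^ (-((n : ℝ) + s))) =
      S.indicator fun y => ‖x - y‖ ^ (-((n : ℝ) + s)) := by
    ext y
    by_cases hy : y ∈ S <;> simp [hy]
  rw [h, setIntegral_indicator hS, inter_eq_right.2 hST, fracPot]

lemma setIntegral_crossInd {n : ℕ} [NeZero n] (s : ℝ) {b ε : ℝ} {x : EuclideanSpace ℝ (Fin n)}
    (hε : ε < |‖x‖ - b|) :
    ∫ y in {y | ε < ‖x - y‖}, crossInd ‖x‖ b y * ‖x - y‖ ^ (-((n : ℝ) + s)) =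
      crossPot n s ‖x‖ b := by
  by_cases hab : ‖x‖ < b
  · rw [abs_of_neg (sub_neg.2 hab), neg_sub] at hε
    simp only [crossInd_of_lt hab]
    rw [crossPot, if_pos hab, ← fracPot_compl_ball_eq]
    exact setIntegral_indicator_kernel s measurableSet_ball.compl
      (fun y hy => hε.trans_le (le_norm_sub_of_notMem_ball hy)) x
  · rw [abs_of_nonneg (by linarith)] at hε
    simp only [crossInd_of_not_lt hab, neg_mul]
    rw [integral_neg, crossPot, if_neg hab, ← fracPot_ball_eq]
    congr 1
    exact setIntegral_indicator_kernel s measurableSet_ball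
      (fun y hy => hε.trans_le (le_norm_sub_of_mem_ball hy)) x

lemma hasFracMeanCurvAt_shells {n N : ℕ} [NeZero n] {s : ℝ} (hs : s ∈ Ioo (0 : ℝ) 1) {r : ℕ → ℝ}
    (h1 : 0 < r 1) (hr : ∀ i, 1 ≤ i → i < 2 * N → r i < r (i + 1)) {i : ℕ}
    (hi : i ∈ Finset.Icc 1 (2 * N)) {x : EuclideanSpace ℝ (Fin n)} (hx : ‖x‖ = r i) :
    HasFracMeanCurvAt n s (shells n N r) x ((-1) ^ i * (r i ^ (-s) * ballCurv n s +
      2 * ∑ j ∈ (Finset.Icc 1 (2 * N)).erase i,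
        (-1 : ℝ) ^ i * ((-1 : ℝ) ^ j * crossPot n s (r i) (r j)))) := by
  have hi' := Finset.mem_Icc.1 hi
  have hx0 : 0 < ‖x‖ := by
    rw [hx]
    rcases hi'.1.eq_or_lt with rfl | h
    · exact h1
    · exact h1.trans (strictMono_of_step hr le_rfl h hi'.2)
  have hlim := ((tendsto_ball_curvature (n := n) hs hx0).const_mul ((-1) ^ i)).add_const
    (∑ j ∈ (Finset.Icc 1 (2 * N)).erase i, 2 * (-1) ^ j * crossPot n s ‖x‖ (r j))
  have hval : (-1) ^ i * (r i ^ (-s) * ballCurv n s + 2 * ∑ j ∈ (Finset.Icc 1 (2 * N)).erase i,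
      (-1 : ℝ) ^ i * ((-1 : ℝ) ^ j * crossPot n s (r i) (r j))) =
      (-1) ^ i * (‖x‖ ^ (-s) * ballCurv n s) +
        ∑ j ∈ (Finset.Icc 1 (2 * N)).erase i, 2 * (-1) ^ j * crossPot n s ‖x‖ (r j) := by
    have hsq : ((-1 : ℝ) ^ i) * (-1) ^ i = 1 := by rw [← mul_pow]; simp
    rw [hx, mul_add, Finset.mul_sum, Finset.mul_sum]
    congr 1
    refine Finset.sum_congr rfl fun j _ => ?_
    linear_combination (2 * (-1) ^ j * crossPot n s (r i) (r j)) * hsq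
  unfold HasFracMeanCurvAt
  rw [hval]
  refine hlim.congr' ?_
  have hsmall : ∀ᶠ ε in 𝓝[>] (0 : ℝ), ∀ j ∈ (Finset.Icc 1 (2 * N)).erase i,
      ε < |‖x‖ - r j| := by
    refine (Finset.eventually_all _).2 fun j hj => nhdsWithin_le_nhds (eventually_lt_nhds ?_)
    rw [Finset.mem_erase, Finset.mem_Icc] at hj
    rw [abs_pos, sub_ne_zero, hx]
    rcases lt_or_gt_of_ne hj.1 with h | h
    · exact (strictMono_of_step hr hj.2.1 h hi'.2).ne'
    · exact (strictMono_of_step hr hi'.1 h hj.2.2).ne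
  filter_upwards [hsmall, self_mem_nhdsWithin] with ε hε hε0
  have hset : {y | ε < dist y x} = {y | ε < ‖x - y‖} := by
    ext y
    rw [mem_ofPred_eq, mem_ofPred_eq, dist_comm, dist_eq_norm]
  simp only [hset, signed_indicator_shells hr hi, add_mul, Finset.sum_mul, mul_assoc]
  have hI1 := integrableOn_bounded_mul_kernel hs.1 hε0 x
    (w := fun y => 1 - 2 * (ball 0 (r i)).indicator (fun _ => (1 : ℝ)) y)
    (measurable_const.sub (measurable_const.mul (measurable_const.indicator measurableSet_ball)))
    (fun y => by
      by_cases h : y ∈ ball (0 : EuclideanSpace ℝ (Fin n)) (r i) <;> simp only [h,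
        indicator_of_mem, indicator_of_notMem, not_false_eq_true] <;> norm_num)
  have hI2 := fun j => integrableOn_bounded_mul_kernel hs.1 hε0 x
    (measurable_crossInd (n := n) (r i) (r j)) (abs_crossInd_le (r i) (r j))
  rw [integral_add (hI1.const_mul _)
    (integrable_finsetSum _ fun j _ => ((hI2 j).const_mul _).const_mul _),
    integral_finsetSum _ fun j _ => ((hI2 j).const_mul _).const_mul _, integral_const_mul, hx]
  congr 1
  refine Finset.sum_congr rfl fun j hj => ?_
  rw [integral_const_mul, integral_const_mul, ← hx, setIntegral_crossInd s (hε j hj)]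

theorem symmetric_shrinker_exists (n : ℕ) (hn : 1 ≤ n) (s : ℝ)
    (hs : s ∈ Set.Ioo (0 : ℝ) 1) (N : ℕ) (hN : 1 ≤ N) (R : ℝ) (hR : 0 < R) :
    ∃ r : ℕ → ℝ, 0 < r 1 ∧ (∀ i, 1 ≤ i → i < 2 * N → r i < r (i + 1)) ∧ r (2 * N) = R ∧
      ∃ H : ℕ → ℝ,
        (∀ i ∈ Finset.Icc 1 (2 * N),
          ∀ x : EuclideanSpace ℝ (Fin n), ‖x‖ = r i →
            HasFracMeanCurvAt n s
              (⋃ k ∈ Finset.Icc 1 N,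
                (Metric.ball (0 : EuclideanSpace ℝ (Fin n)) (r (2 * k)) \
                  Metric.ball 0 (r (2 * k - 1)))) x (H i)) ∧
        (∀ i ∈ Finset.Icc 1 (2 * N - 1),
          r i * H (2 * N) + (-1 : ℝ) ^ (i + 1) * R * H i = 0) := by
  have : NeZero n := ⟨by omega⟩
  obtain ⟨q, hq1, hstep, hq⟩ := exists_balanced_radii n hs (m := 2 * N) (by omega)
  have hqR : 0 < q (2 * N) := hq1.trans (strictMono_of_step hstep le_rfl (by omega) le_rfl)
  set t := R / q (2 * N) with ht
  have ht0 : 0 < t := div_pos hR hqR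
  have htR : t * q (2 * N) = R := div_mul_cancel₀ R hqR.ne'
  have hstep' : ∀ i, 1 ≤ i → i < 2 * N → t * q i < t * q (i + 1) :=
    fun i h1 h2 => mul_lt_mul_of_pos_left (hstep i h1 h2) ht0
  have hpos : ∀ i ∈ Finset.Icc 1 (2 * N), 0 < q i := by
    intro i hi
    rw [Finset.mem_Icc] at hi
    rcases hi.1.eq_or_lt with rfl | h
    · exact hq1
    · exact hq1.trans (strictMono_of_step hstep le_rfl h hi.2)
  refine ⟨fun i => t * q i, mul_pos ht0 hq1, hstep', htR,
    fun i => (-1) ^ i * (t ^ (-s) * ((n + 1) * q i)), fun i hi x hx => ?_, fun i _ => ?_⟩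
  · have h := hasFracMeanCurvAt_shells hs (mul_pos ht0 hq1) hstep' hi hx
    simp only [crossPot_smul s ht0, Real.mul_rpow ht0.le (hpos i hi).le] at h
    refine (congrArg (HasFracMeanCurvAt n s _ x) ?_).mpr h
    dsimp only
    congr 1
    rw [← hq i hi, mul_add, Finset.mul_sum, Finset.mul_sum, Finset.mul_sum, mul_assoc]
    congr 1
    exact Finset.sum_congr rfl fun j _ => by ring
  · have hsq : ((-1 : ℝ) ^ i) * (-1) ^ i = 1 := by rw [← mul_pow]; simp
    have heven : (-1 : ℝ) ^ (2 * N) = 1 := by rw [pow_mul]; simp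
    dsimp only
    rw [heven, pow_succ, ← htR]
    linear_combination (-t * q (2 * N) * t ^ (-s) * (n + 1) * q i) * hsq
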